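/- arXiv:1803.03696 — 2 statements merged into one kernel-verified Lean document; each statement's English description precedes it below -/
import Mathlib

section
/- Let (G,σ) be a 2-edge-connected signed graph whose negativeness ε(G,σ) is even. Then (G,σ) has a signed-circuit cover 𝓕 with ℓ(𝓕) < (8/3)|E(G)|, i.e., 3ℓ(𝓕) < 8|E(G)|. -/
open SimpleGraph Set

variable {V : Type*}

/-- `J` is a `T`-join of `G`: a set of edges of `G` such that a vertex has odd degree
in the spanning subgraph with edge set `J` iff it belongs to `T`. -/
def IsTJoin (G : SimpleGraph V) (T : Set V) (J : Set (Sym2 V)) : Prop :=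
  J ⊆ G.edgeSet ∧ ∀ v : V, (Odd {e ∈ J | v ∈ e}.ncard ↔ v ∈ T)

/-- The edge set of the maximal bridgeless subgraph of `G`: all non-bridge edges. -/
def nonBridgeEdges (G : SimpleGraph V) : Set (Sym2 V) :=
  {e ∈ G.edgeSet | ¬ G.IsBridge e}

/-- A graph is 2-edge-connected if it is connected, has at least two vertices,
and has no bridge. -/
def TwoEdgeConnected (G : SimpleGraph V) : Prop :=
  G.Connected ∧ Nontrivial V ∧ ∀ e, ¬ G.IsBridge e

/-- `H` is the edge set of an even subgraph of `G`: every vertex has even degree. -/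
def IsEvenEdgeSet (G : SimpleGraph V) (H : Set (Sym2 V)) : Prop :=
  H ⊆ G.edgeSet ∧ ∀ v : V, Even {e ∈ H | v ∈ e}.ncard

/-! Signed graphs: a signature is `σ : Sym2 V → Bool`, `σ e = true` meaning `e` is negative. -/

/-- The set of negative edges of `(G, σ)`. -/
def negEdgeSet (G : SimpleGraph V) (σ : Sym2 V → Bool) : Set (Sym2 V) :=
  {e ∈ G.edgeSet | σ e = true}

/-- The set of positive edges of `(G, σ)`. -/
def posEdgeSet (G : SimpleGraph V) (σ : Sym2 V → Bool) : Set (Sym2 V) :=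
  {e ∈ G.edgeSet | σ e = false}

/-- `G⁺`: the spanning subgraph of `G` on the positive edges. -/
def gplus (G : SimpleGraph V) (σ : Sym2 V → Bool) : SimpleGraph V :=
  G.deleteEdges {e | σ e = true}

/-- `C` is the edge set and `S` the vertex set of a cycle of `G`. -/
def IsCycleSet (G : SimpleGraph V) (C : Set (Sym2 V)) (S : Set V) : Prop :=
  ∃ (v : V) (w : G.Walk v v), w.IsCycle ∧ C = {e | e ∈ w.edges} ∧ S = {x | x ∈ w.support}

/-- `C` (with vertex set `S`) is a negative cycle: it has an odd number of negative edges. -/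
def IsNegCycle (G : SimpleGraph V) (σ : Sym2 V → Bool) (C : Set (Sym2 V)) (S : Set V) : Prop :=
  IsCycleSet G C S ∧ Odd {e ∈ C | σ e = true}.ncard

/-- `C` is (the edge set of) a positive cycle: it has an even number of negative edges. -/
def IsPosCycle (G : SimpleGraph V) (σ : Sym2 V → Bool) (C : Set (Sym2 V)) : Prop :=
  (∃ S, IsCycleSet G C S) ∧ Even {e ∈ C | σ e = true}.ncard

/-- `B` is a short barbell whose two negative cycles have edge sets `C₁` and `C₂`:
the two negative cycles meet in exactly one vertex. -/
def IsShortBarbellWith (G : SimpleGraph V) (σ : Sym2 V → Bool)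
    (B C₁ C₂ : Set (Sym2 V)) : Prop :=
  ∃ S₁ S₂, IsNegCycle G σ C₁ S₁ ∧ IsNegCycle G σ C₂ S₂ ∧
    (∃ v, S₁ ∩ S₂ = {v}) ∧ B = C₁ ∪ C₂

/-- `B` is a long barbell whose two negative cycles have edge sets `C₁` and `C₂`:
two vertex-disjoint negative cycles joined by a path meeting them only in its endpoints. -/
def IsLongBarbellWith (G : SimpleGraph V) (σ : Sym2 V → Bool)
    (B C₁ C₂ : Set (Sym2 V)) : Prop :=
  ∃ (S₁ S₂ : Set V) (u v : V) (p : G.Walk u v), IsNegCycle G σ C₁ S₁ ∧ IsNegCycle G σ C₂ S₂ ∧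
    Disjoint S₁ S₂ ∧ p.IsPath ∧ u ∈ S₁ ∧ v ∈ S₂ ∧
    {x | x ∈ p.support} ∩ S₁ = {u} ∧ {x | x ∈ p.support} ∩ S₂ = {v} ∧
    B = C₁ ∪ C₂ ∪ {e | e ∈ p.edges}

/-- `B` is a barbell whose two negative cycles have edge sets `C₁` and `C₂`. -/
def IsBarbellWith (G : SimpleGraph V) (σ : Sym2 V → Bool) (B C₁ C₂ : Set (Sym2 V)) : Prop :=
  IsShortBarbellWith G σ B C₁ C₂ ∨ IsLongBarbellWith G σ B C₁ C₂

/-- `B` is (the edge set of) a barbell of `(G, σ)`. -/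
def IsBarbell (G : SimpleGraph V) (σ : Sym2 V → Bool) (B : Set (Sym2 V)) : Prop :=
  ∃ C₁ C₂, IsBarbellWith G σ B C₁ C₂

/-- A signed-circuit is a positive cycle or a barbell. -/
def IsSignedCircuit (G : SimpleGraph V) (σ : Sym2 V → Bool) (D : Set (Sym2 V)) : Prop :=
  IsPosCycle G σ D ∨ IsBarbell G σ D

open Classical in
/-- `τ(G,σ)`: `|E(G)|` if there is no barbell, otherwise the minimum over all barbells of
the total number of edges of its two negative cycles. -/
noncomputable def tau (G : SimpleGraph V) (σ : Sym2 V → Bool) : ℕ :=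
  if ∃ B, IsBarbell G σ B then
    sInf {n | ∃ B C₁ C₂, IsBarbellWith G σ B C₁ C₂ ∧ n = C₁.ncard + C₂.ncard}
  else G.edgeSet.ncard

/-- The length of a family of signed-circuits (counted with multiplicity). -/
noncomputable def circuitLength (𝓕 : Multiset (Set (Sym2 V))) : ℕ := (𝓕.map Set.ncard).sum

/-- `𝓕` is a signed-circuit cover of `(G, σ)`. -/
def IsSignedCircuitCover (G : SimpleGraph V) (σ : Sym2 V → Bool)
    (𝓕 : Multiset (Set (Sym2 V))) : Prop :=
  (∀ C ∈ 𝓕, IsSignedCircuit G σ C) ∧ ∀ e ∈ G.edgeSet, ∃ C ∈ 𝓕, e ∈ C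

/-- `e` has exactly one endpoint in `U`. -/
def Crosses (U : Set V) (e : Sym2 V) : Prop :=
  ∃ x y, e = s(x, y) ∧ x ∈ U ∧ y ∉ U

open Classical in
/-- The signature obtained from `σ` by switching at the vertex set `U`. -/
noncomputable def switchSign (σ : Sym2 V → Bool) (U : Set V) : Sym2 V → Bool :=
  fun e => if Crosses U e then !(σ e) else σ e

/-- Two signatures are equivalent if one is obtained from the other by switching. -/
def EquivSign (σ σ' : Sym2 V → Bool) : Prop := ∃ U : Set V, σ' = switchSign σ U

/-- The minimum number of negative edges lying entirely inside `W`, over all signatures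
equivalent to `σ` (the negativeness of the signed subgraph induced on `W`). -/
noncomputable def negOn (G : SimpleGraph V) (σ : Sym2 V → Bool) (W : Set V) : ℕ :=
  sInf {n | ∃ U : Set V,
    n = {e | e ∈ G.edgeSet ∧ (∀ x ∈ e, x ∈ W) ∧ switchSign σ U e = true}.ncard}

/-- The negativeness `ε(G,σ)`. -/
noncomputable def negativeness (G : SimpleGraph V) (σ : Sym2 V → Bool) : ℕ :=
  negOn G σ Set.univ

/-- The signed subgraph induced on `W` is balanced. -/
def BalancedOn (G : SimpleGraph V) (σ : Sym2 V → Bool) (W : Set V) : Prop :=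
  negOn G σ W = 0

/-- `(G, σ)` is flow-admissible: each connected component has negativeness ≠ 1, and
for every bridge, neither of the two components obtained by deleting it is balanced. -/
def FlowAdmissible (G : SimpleGraph V) (σ : Sym2 V → Bool) : Prop :=
  ∀ x : V,
    negOn G σ {y | G.Reachable x y} ≠ 1 ∧
    ∀ e ∈ G.edgeSet, G.IsBridge e → (∀ z ∈ e, G.Reachable x z) →
      ∀ z ∈ e, ¬ BalancedOn G σ {y | (G.deleteEdges {e}).Reachable z y}

/-- `{e, f}` is a 2-edge-cut of `G`. -/
def IsTwoEdgeCut (G : SimpleGraph V) (e f : Sym2 V) : Prop :=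
  e ∈ G.edgeSet ∧ f ∈ G.edgeSet ∧ e ≠ f ∧ ¬ G.IsBridge e ∧ ¬ G.IsBridge f ∧
    ¬ (G.deleteEdges {e, f}).Connected

set_option linter.unusedSectionVars false
/-! ## Part 1: flows as antisymmetric functions -/
namespace SC
open Relation
open scoped Classical

section flows
variable [Fintype V]

/-- a function of two vertices is antisymmetric -/
def Anti {R : Type*} [Neg R] (f : V → V → R) : Prop := ∀ x y, f y x = - f x y

/-- the excess of an antisymmetric function at a vertex -/
def exc {R : Type*} [AddCommMonoid R] (f : V → V → R) (v : V) : R := ∑ w, f v w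

/-- the unit flow along the arc `u → w` -/
noncomputable def arc (u w x y : V) : ℤ :=
  (if x = u ∧ y = w then 1 else 0) - (if x = w ∧ y = u then 1 else 0)

lemma arc_anti (u w : V) : Anti (arc u w) := by
  intro x y; unfold arc; simp only [and_comm]; ring

lemma arc_exc (u w x : V) :
    exc (arc u w) x = (if x = u then 1 else 0) - (if x = w then 1 else 0) := by
  unfold exc arc
  rw [Finset.sum_sub_distrib]
  congr 1
  · by_cases h : x = u <;> simp [h]
  · by_cases h : x = w <;> simp [h]

lemma sum_inner_anti {R : Type*} [AddCommGroup R] (f : V → V → R) (hf : Anti f)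
    (X : Finset V) : ∑ x ∈ X, ∑ y ∈ X, f x y = - ∑ x ∈ X, ∑ y ∈ X, f x y := by
  conv_lhs => rw [Finset.sum_comm]
  rw [← Finset.sum_neg_distrib]
  refine Finset.sum_congr rfl fun x _ => ?_
  rw [← Finset.sum_neg_distrib]
  exact Finset.sum_congr rfl fun y _ => hf _ _

lemma sum_exc {R : Type*} [AddCommGroup R] (h2 : ∀ a : R, a = -a → a = 0)
    (f : V → V → R) (hf : Anti f) (X : Finset V) :
    ∑ x ∈ X, exc f x = ∑ x ∈ X, ∑ y ∈ Xᶜ, f x y := by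
  have h : ∀ x, exc f x = ∑ y ∈ X, f x y + ∑ y ∈ Xᶜ, f x y := fun x => by
    unfold exc; rw [Finset.sum_add_sum_compl]
  simp only [h, Finset.sum_add_distrib]
  rw [h2 _ (sum_inner_anti f hf X), zero_add]

lemma int_two (a : ℤ) (h : a = -a) : a = 0 := by omega

lemma zmod3_two (a : ZMod 3) (h : a = -a) : a = 0 := by revert a; decide

lemma reach_avoid (r : V → V → Prop) (u v : V) (huv : u ≠ v) (a : V) (h : ReflTransGen r a v) :
    (a ≠ u ∧ ReflTransGen (fun x y => r x y ∧ x ≠ u ∧ y ≠ u) a v) ∨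
    ∃ w, r u w ∧ w ≠ u ∧ ReflTransGen (fun x y => r x y ∧ x ≠ u ∧ y ≠ u) w v := by
  induction h using ReflTransGen.head_induction_on with
  | refl => exact Or.inl ⟨huv.symm, .refl⟩
  | head hab _ ih =>
    rename_i a b _
    rcases ih with ⟨hb, ih⟩ | ih
    · by_cases ha : a = u
      · subst ha; exact Or.inr ⟨b, hab, hb, ih⟩
      · exact Or.inl ⟨ha, .head ⟨hab, ha, hb⟩ ih⟩
    · exact Or.inr ih

lemma aug_aux (n : ℕ) : ∀ (r : V → V → Prop) (X : Finset V), X.card = n →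
    (∀ x y, r x y → x ∈ X ∧ y ∈ X) → ∀ u v, ReflTransGen r u v →
    ∃ g : V → V → ℤ, Anti g ∧ (∀ x y, g x y ≤ 1) ∧ (∀ x y, 0 < g x y → r x y) ∧
      ∀ x, exc g x = (if x = u then 1 else 0) - (if x = v then 1 else 0) := by
  induction n with
  | zero =>
    intro r X hX hr u v h
    have : u = v := by
      rcases h.cases_head with h | ⟨c, hc, _⟩
      · exact h
      · have := (hr _ _ hc).1; simp [Finset.card_eq_zero.1 hX] at this
    subst this
    exact ⟨fun _ _ => 0, fun _ _ => by simp, by simp, by simp, fun x => by simp [exc]⟩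
  | succ n ih =>
    intro r X hX hr u v h
    by_cases huv : u = v
    · subst huv
      exact ⟨fun _ _ => 0, fun _ _ => by simp, by simp, by simp, fun x => by simp [exc]⟩
    rcases reach_avoid r u v huv u h with ⟨h1, _⟩ | ⟨w, huw, hwu, hw⟩
    · exact absurd rfl h1
    have huX := (hr _ _ huw).1
    obtain ⟨g, ga, g1, gr, ge⟩ := ih (fun x y => r x y ∧ x ≠ u ∧ y ≠ u) (X.erase u)
      (by rw [Finset.card_erase_of_mem huX, hX]; rfl)
      (fun x y hxy => by
        have := hr _ _ hxy.1
        simp [this.1, this.2, hxy.2.1, hxy.2.2]) w v hw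
    have gu : ∀ y, g u y = 0 := by
      intro y
      by_contra hne
      rcases lt_or_gt_of_ne hne with h0 | h0
      · have : 0 < g y u := by rw [ga u y]; omega
        exact (gr _ _ this).2.2 rfl
      · exact (gr _ _ h0).2.1 rfl
    have gu' : ∀ y, g y u = 0 := fun y => by rw [ga u y, gu]; rfl
    refine ⟨fun x y => g x y + arc u w x y, ?_, ?_, ?_, ?_⟩
    · intro x y; dsimp; rw [ga x y, arc_anti u w x y]; ring
    · intro x y
      dsimp
      unfold arc
      by_cases hx : x = u
      · subst hx; rw [gu]; split_ifs <;> simp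
      · have := g1 x y
        simp only [hx, false_and, if_false]
        split_ifs <;> omega
    · intro x y hxy
      dsimp at hxy
      unfold arc at hxy
      by_cases hx : x = u ∧ y = w
      · rw [hx.1, hx.2]; exact huw
      · simp only [hx, if_false] at hxy
        have : 0 < g x y := by split_ifs at hxy <;> omega
        exact (gr _ _ this).1
    · intro x
      have : exc (fun x y => g x y + arc u w x y) x = exc g x + exc (arc u w) x := by
        simp [exc, Finset.sum_add_distrib]
      rw [this, ge, arc_exc]; ring

lemma aug (r : V → V → Prop) (u v : V) (h : ReflTransGen r u v) :
    ∃ g : V → V → ℤ, Anti g ∧ (∀ x y, g x y ≤ 1) ∧ (∀ x y, 0 < g x y → r x y) ∧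
      ∀ x, exc g x = (if x = u then 1 else 0) - (if x = v then 1 else 0) :=
  aug_aux _ r Finset.univ rfl (fun _ _ _ => by simp) u v h

/-- lifting a modular flow to an integer flow (Tutte) -/
lemma lift (k : ℤ) (hk : 0 < k) (f : V → V → ℤ) (fa : Anti f) (fb : ∀ x y, |f x y| < k)
    (hd : ∀ v, k ∣ exc f v) :
    ∃ f' : V → V → ℤ, Anti f' ∧ (∀ x y, |f' x y| < k) ∧ (∀ x y, k ∣ f' x y - f x y) ∧
      ∀ v, exc f' v = 0 := by
  let P : ℕ → Prop := fun n => ∃ f' : V → V → ℤ, Anti f' ∧ (∀ x y, |f' x y| < k) ∧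
    (∀ x y, k ∣ f' x y - f x y) ∧ ∑ v, (exc f' v).natAbs = n
  have hP : ∃ n, P n := ⟨_, f, fa, fb, fun x y => by simp, rfl⟩
  obtain ⟨f', fa', fb', fd', hs⟩ := Nat.find_spec hP
  have hmin := fun m hm => Nat.find_min hP (m := m) hm
  refine ⟨f', fa', fb', fd', ?_⟩
  by_contra hne
  push Not at hne
  have hk' : ∀ v, k ∣ exc f' v := by
    intro v
    have : exc f' v = exc f v + ∑ w, (f' v w - f v w) := by
      simp [exc, Finset.sum_sub_distrib]
    rw [this]
    exact dvd_add (hd v) (Finset.dvd_sum fun w _ => fd' v w)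
  have htot : ∑ v, exc f' v = 0 := by
    have := sum_exc int_two f' fa' Finset.univ
    simpa using this
  obtain ⟨v, hv⟩ : ∃ v, 0 < exc f' v := by
    by_contra hcon
    push Not at hcon
    obtain ⟨v, hv⟩ := hne
    exact hv ((Finset.sum_eq_zero_iff_of_nonpos (fun i _ => hcon i)).1 htot v (Finset.mem_univ v))
  let r : V → V → Prop := fun x y => 0 < f' x y
  let R : Finset V := Finset.univ.filter (fun x => ReflTransGen r v x)
  have hR : ∑ x ∈ R, exc f' x ≤ 0 := by
    rw [sum_exc int_two f' fa']
    refine Finset.sum_nonpos fun x hx => Finset.sum_nonpos fun y hy => ?_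
    by_contra hxy
    push Not at hxy
    simp only [R, Finset.mem_compl, Finset.mem_filter, Finset.mem_univ, true_and] at hx hy
    exact hy (hx.tail hxy)
  obtain ⟨u, huR, hu⟩ : ∃ u ∈ R, exc f' u < 0 := by
    by_contra hcon
    push Not at hcon
    have hvR : v ∈ R := by simp [R]; exact .refl
    have := Finset.single_le_sum hcon hvR
    omega
  have huv : u ≠ v := by rintro rfl; omega
  simp only [R, Finset.mem_filter, Finset.mem_univ, true_and] at huR
  obtain ⟨g, ga, g1, gr, ge⟩ := aug r v u huR
  have hexc : ∀ x, exc (fun x y => f' x y - k * g x y) x = exc f' x - k * exc g x := by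
    intro x; simp [exc, Finset.sum_sub_distrib, Finset.mul_sum]
  have key : ∑ x, (exc (fun x y => f' x y - k * g x y) x).natAbs < ∑ x, (exc f' x).natAbs := by
    have hu' := hk' u
    have hv' := hk' v
    obtain ⟨a, ha⟩ := hu'
    obtain ⟨b, hb⟩ := hv'
    have hb1 : k ≤ exc f' v := Int.le_of_dvd hv ⟨b, hb⟩
    have ha1 : k ≤ - exc f' u := Int.le_of_dvd (by omega) ((hk' u).neg_right)
    refine Finset.sum_lt_sum ?_ ⟨v, Finset.mem_univ _, ?_⟩
    · intro x _
      rw [hexc, ge]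
      by_cases h1 : x = v
      · subst h1; simp [huv.symm]; omega
      · by_cases h2 : x = u
        · subst h2; simp [huv]; omega
        · simp [h1, h2]
    · rw [hexc, ge]; simp [huv.symm]; omega
  refine hmin _ (hs ▸ key) ⟨fun x y => f' x y - k * g x y, ?_, ?_, ?_, rfl⟩
  · intro x y; dsimp; rw [fa' x y, ga x y]; ring
  · intro x y
    dsimp
    have h1 := g1 x y
    have h2 := g1 y x
    rw [ga x y] at h2
    have h3 := fb' x y
    rw [abs_lt] at h3 ⊢
    rcases lt_trichotomy (g x y) 0 with h | h | h
    · have h0 : g x y = -1 := by omega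
      have h4 : 0 < f' y x := gr y x (by rw [ga x y]; omega)
      rw [fa' x y] at h4
      rw [h0]; constructor <;> linarith
    · rw [h]; constructor <;> linarith
    · have h0 : g x y = 1 := by omega
      have h4 : 0 < f' x y := gr x y h
      rw [h0]; constructor <;> linarith
  · intro x y
    have : f' x y - k * g x y - f x y = (f' x y - f x y) - k * g x y := by ring
    dsimp; rw [this]
    exact dvd_sub (fd' x y) (dvd_mul_right _ _)

end flows
end SC

/-! ## Part 2: edge sets, parity -/
namespace SC
open Relation
open scoped Classical

section edgesets
variable [Fintype V]

/-- parity of the degree of `v` in a loopless edge set `A` -/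
noncomputable def bd (A : Finset (Sym2 V)) (v : V) : ZMod 2 := ∑ w, if s(v, w) ∈ A then 1 else 0

/-- no loops -/
def LL (A : Finset (Sym2 V)) : Prop := ∀ v, s(v, v) ∉ A

/-- reachability by edges of `A` -/
def Rch (A : Finset (Sym2 V)) : V → V → Prop := ReflTransGen (fun x y => s(x, y) ∈ A)

lemma LL.mono {A B : Finset (Sym2 V)} (h : LL B) (hAB : A ⊆ B) : LL A := fun v hv => h v (hAB hv)

lemma Rch.symm {A : Finset (Sym2 V)} {x y : V} (h : Rch A x y) : Rch A y x := by
  induction h with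
  | refl => exact ReflTransGen.refl
  | tail _ hbc ih => exact ReflTransGen.head (by rw [Sym2.eq_swap]; exact hbc) ih

lemma Rch.mono {A B : Finset (Sym2 V)} (hAB : A ⊆ B) {x y : V} (h : Rch A x y) : Rch B x y :=
  ReflTransGen.mono (fun _ _ h => hAB h) _ _ h

lemma Rch.trans {A : Finset (Sym2 V)} {x y z : V} (h : Rch A x y) (h' : Rch A y z) : Rch A x z :=
  ReflTransGen.trans h h'

lemma Rch.single {A : Finset (Sym2 V)} {x y : V} (h : s(x, y) ∈ A) : Rch A x y :=
  ReflTransGen.single h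

lemma Rch.refl {A : Finset (Sym2 V)} (x : V) : Rch A x x := ReflTransGen.refl

lemma bd_symmDiff (A B : Finset (Sym2 V)) (v : V) : bd (symmDiff A B) v = bd A v + bd B v := by
  unfold bd
  rw [← Finset.sum_add_distrib]
  refine Finset.sum_congr rfl fun w _ => ?_
  by_cases h1 : s(v, w) ∈ A <;> by_cases h2 : s(v, w) ∈ B <;> simp [Finset.mem_symmDiff, h1, h2]
  decide

lemma bd_union {A B : Finset (Sym2 V)} (h : Disjoint A B) (v : V) :
    bd (A ∪ B) v = bd A v + bd B v := by
  rw [← bd_symmDiff, h.symmDiff_eq_sup]; rfl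

lemma bd_sdiff {A B : Finset (Sym2 V)} (h : B ⊆ A) (v : V) :
    bd (A \ B) v = bd A v + bd B v := by
  rw [← bd_symmDiff, symmDiff_of_ge (by exact h)]

lemma bd_empty (v : V) : bd (∅ : Finset (Sym2 V)) v = 0 := by simp [bd]

lemma bd_single {x y : V} (h : x ≠ y) (v : V) :
    bd {s(x, y)} v = (if v = x then 1 else 0) + (if v = y then 1 else 0) := by
  unfold bd
  simp only [Finset.mem_singleton, Sym2.eq_iff]
  by_cases h1 : v = x
  · subst h1; simp [h]
  · by_cases h2 : v = y
    · subst h2; simp [h.symm]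
    · simp [h1, h2]

lemma bd_cut {A : Finset (Sym2 V)} (hA : LL A) (X : Finset V) :
    ∑ v ∈ X, bd A v = ∑ v ∈ X, ∑ w ∈ Xᶜ, if s(v, w) ∈ A then 1 else 0 := by
  have h : ∀ x, bd A x = (∑ y ∈ X, if s(x, y) ∈ A then 1 else 0) +
      ∑ y ∈ Xᶜ, if s(x, y) ∈ A then 1 else 0 := fun x => by
    unfold bd; rw [Finset.sum_add_sum_compl]
  simp only [h, Finset.sum_add_distrib]
  have : ∑ x ∈ X, ∑ y ∈ X, (if s(x, y) ∈ A then (1 : ZMod 2) else 0) = 0 := by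
    rw [← Finset.sum_product']
    refine Finset.sum_involution (fun p _ => p.swap) ?_ ?_ ?_ ?_
    · intro p _
      have : s(p.2, p.1) = s(p.1, p.2) := Sym2.eq_swap
      simp only [Prod.fst_swap, Prod.snd_swap, this]
      split_ifs <;> decide
    · intro p _ hp hsw
      have : p.1 = p.2 := (congrArg Prod.fst hsw).symm
      rw [this] at hp
      simp at hp
      exact hA _ hp
    · intro p hp
      simp at hp ⊢; exact hp.symm
    · intro p _; simp
  rw [this, zero_add]

lemma parity_reach {A : Finset (Sym2 V)} (hA : LL A) {u v : V}
    (h : ∀ x, bd A x = (if x = u then 1 else 0) + (if x = v then 1 else 0)) : Rch A u v := by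
  by_contra hcon
  have hc := bd_cut hA (Finset.univ.filter (fun x => Rch A u x))
  have h0 : ∑ v ∈ Finset.univ.filter (fun x => Rch A u x),
      ∑ w ∈ (Finset.univ.filter (fun x => Rch A u x))ᶜ,
        (if s(v, w) ∈ A then (1 : ZMod 2) else 0) = 0 := by
    refine Finset.sum_eq_zero fun x hx => Finset.sum_eq_zero fun y hy => ?_
    rw [if_neg]
    intro hxy
    simp at hx hy
    exact hy (hx.trans (Rch.single hxy))
  rw [h0] at hc
  simp only [h, Finset.sum_add_distrib] at hc
  simp [hcon, Rch.refl] at hc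

lemma pathset {P : Finset (Sym2 V)} (hP : LL P) {u v : V} (h : Rch P u v) :
    ∃ A ⊆ P, ∀ x, bd A x = (if x = u then 1 else 0) + (if x = v then 1 else 0) := by
  induction h with
  | refl => exact ⟨∅, by simp, fun x => by rw [bd_empty]; split_ifs <;> decide⟩
  | tail _ hbc ih =>
    rename_i b c _
    obtain ⟨A, hA, hb⟩ := ih
    have hbc' : b ≠ c := by rintro rfl; exact hP _ hbc
    refine ⟨symmDiff A {s(b, c)}, ?_, ?_⟩
    · intro e he
      rw [Finset.mem_symmDiff] at he
      rcases he with he | he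
      · exact hA he.1
      · simp at he; rw [he.1]; exact hbc
    · intro x
      rw [bd_symmDiff, hb, bd_single hbc']
      have : ∀ a b c : ZMod 2, a + b + (b + c) = a + c := by decide
      exact this _ _ _

/-- edge set of a relation -/
noncomputable def es (p : V → V → Prop) : Finset (Sym2 V) :=
  Finset.univ.filter (fun e => ∃ x y, e = s(x, y) ∧ p x y)

lemma mem_es {p : V → V → Prop} (hp : ∀ x y, p x y → p y x) {x y : V} :
    s(x, y) ∈ es p ↔ p x y := by
  simp only [es, Finset.mem_filter, Finset.mem_univ, true_and]
  constructor
  · rintro ⟨a, b, h, hab⟩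
    rw [Sym2.eq_iff] at h
    rcases h with ⟨rfl, rfl⟩ | ⟨rfl, rfl⟩
    · exact hab
    · exact hp _ _ hab
  · intro h; exact ⟨x, y, rfl, h⟩

/-- pairs joined by edges of `M` -/
noncomputable def D (M : Finset (Sym2 V)) (X Y : Finset V) : Finset (V × V) :=
  (X ×ˢ Y).filter (fun p => s(p.1, p.2) ∈ M)

lemma mem_D {M : Finset (Sym2 V)} {X Y : Finset V} {p : V × V} :
    p ∈ D M X Y ↔ (p.1 ∈ X ∧ p.2 ∈ Y) ∧ s(p.1, p.2) ∈ M := by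
  simp [D]

lemma D_swap (M : Finset (Sym2 V)) (X Y : Finset V) : (D M X Y).card = (D M Y X).card := by
  refine Finset.card_bij (fun p _ => p.swap) ?_ ?_ ?_
  · intro p hp
    rw [mem_D] at *
    refine ⟨⟨hp.1.2, hp.1.1⟩, ?_⟩
    rw [Sym2.eq_swap]; exact hp.2
  · intro p _ q _ h; exact Prod.swap_injective h
  · intro p hp
    refine ⟨p.swap, ?_, by simp⟩
    rw [mem_D] at *
    refine ⟨⟨hp.1.2, hp.1.1⟩, ?_⟩
    rw [Sym2.eq_swap]; exact hp.2

lemma D_union_right (M : Finset (Sym2 V)) (X : Finset V) {Y Z : Finset V} (h : Disjoint Y Z) :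
    (D M X (Y ∪ Z)).card = (D M X Y).card + (D M X Z).card := by
  rw [← Finset.card_union_of_disjoint]
  · congr 1; ext p; simp only [mem_D, Finset.mem_union]; tauto
  · rw [Finset.disjoint_left] at *
    intro p hp hp'
    rw [mem_D] at *
    exact h hp.1.2 hp'.1.2

lemma D_union_left (M : Finset (Sym2 V)) (X : Finset V) {Y Z : Finset V} (h : Disjoint Y Z) :
    (D M (Y ∪ Z) X).card = (D M Y X).card + (D M Z X).card := by
  rw [D_swap, D_union_right M X h, D_swap M X Y, D_swap M X Z]

lemma cut_card (A : Finset (Sym2 V)) (hA : LL A) (X : Finset V) :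
    ((D A X Xᶜ).card : ZMod 2) = ∑ v ∈ X, bd A v := by
  rw [bd_cut hA, D, Finset.card_filter, Finset.sum_product]
  push_cast
  rfl

lemma cut_even {A : Finset (Sym2 V)} (hA : LL A) (h0 : ∀ v, bd A v = 0) (X : Finset V) :
    Even (D A X Xᶜ).card := by
  have := cut_card A hA X
  simp only [h0, Finset.sum_const_zero] at this
  exact (ZMod.natCast_eq_zero_iff_even).1 this

lemma augE (K : Finset (Sym2 V)) {u v : V} (h : Rch K u v) :
    ∃ g : V → V → ℤ, Anti g ∧ (∀ x y, g x y ≠ 0 → s(x, y) ∈ K) ∧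
      ∀ x, exc g x = (if x = u then 1 else 0) - (if x = v then 1 else 0) := by
  obtain ⟨g, ga, -, gr, ge⟩ := aug _ u v h
  refine ⟨g, ga, ?_, ge⟩
  intro x y hxy
  rcases lt_or_gt_of_ne hxy with h | h
  · rw [Sym2.eq_swap]; exact gr y x (by rw [ga x y]; omega)
  · exact gr x y h

lemma menger_step (M : Finset (Sym2 V)) (X : Finset V)
    (hcut : ∀ Y ⊆ X, Y.Nonempty → Y ≠ X → 2 ≤ (D M Y (X \ Y)).card)
    {x1 x2 : V} (h1 : x1 ∈ X) (h2 : x2 ∈ X) (hne : x1 ≠ x2) (c : ℤ) (hc : c ≤ 1)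
    (f : V → V → ℤ) (fa : Anti f) (f1 : ∀ x y, f x y ≤ 1)
    (fs : ∀ x y, f x y ≠ 0 → s(x, y) ∈ M ∧ x ∈ X ∧ y ∈ X)
    (fe : ∀ x, exc f x = c * ((if x = x1 then 1 else 0) - (if x = x2 then 1 else 0))) :
    ∃ f : V → V → ℤ, Anti f ∧ (∀ x y, f x y ≤ 1) ∧
      (∀ x y, f x y ≠ 0 → s(x, y) ∈ M ∧ x ∈ X ∧ y ∈ X) ∧
      (∀ x, exc f x = (c + 1) * ((if x = x1 then 1 else 0) - (if x = x2 then 1 else 0))) := by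
  let r : V → V → Prop := fun x y => (s(x, y) ∈ M ∧ x ∈ X ∧ y ∈ X) ∧ f x y < 1
  have hreach : ReflTransGen r x1 x2 := by
    by_contra hcon
    let R : Finset V := Finset.univ.filter (fun x => ReflTransGen r x1 x)
    have hRX : R ⊆ X := by
      intro x hx
      simp only [R, Finset.mem_filter, Finset.mem_univ, true_and] at hx
      rcases hx.cases_tail with h | ⟨b, _, hb⟩
      · rw [h]; exact h1
      · exact hb.1.2.2
    have hx1R : x1 ∈ R := by simp [R]; exact .refl
    have hx2R : x2 ∉ R := by simp [R, hcon]
    have hcard := hcut R hRX ⟨x1, hx1R⟩ (by rintro h; rw [h] at hx2R; exact hx2R h2)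
    have hsum := sum_exc int_two f fa R
    have hl : ∑ x ∈ R, exc f x = c := by
      simp only [fe, ← Finset.mul_sum, Finset.sum_sub_distrib]
      simp [hx1R, hx2R]
    have hfull : ∀ x ∈ R, ∀ y ∈ Rᶜ, f x y = if s(x, y) ∈ M ∧ y ∈ X then 1 else 0 := by
      intro x hx y hy
      split_ifs with h
      · by_contra hf
        have : f x y < 1 := lt_of_le_of_ne (f1 x y) hf
        have hxX := hRX hx
        simp only [R, Finset.mem_compl, Finset.mem_filter, Finset.mem_univ, true_and] at hx hy
        exact hy (hx.tail ⟨⟨h.1, hxX, h.2⟩, this⟩)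
      · by_contra hf
        have := fs x y hf
        exact h ⟨this.1, this.2.2⟩
    have hr : ∑ x ∈ R, ∑ y ∈ Rᶜ, f x y = (D M R (X \ R)).card := by
      rw [Finset.sum_congr rfl fun x hx => Finset.sum_congr rfl fun y hy => hfull x hx y hy]
      rw [← Finset.sum_product', Finset.sum_ite, Finset.sum_const_zero, add_zero,
        Finset.sum_const, nsmul_eq_mul, mul_one]
      congr 2
      ext p
      simp only [mem_D, Finset.mem_filter, Finset.mem_product, Finset.mem_compl,
        Finset.mem_sdiff]
      tauto
    rw [hl, hr] at hsum
    omega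
  obtain ⟨g, ga, g1, gr, ge⟩ := aug r x1 x2 hreach
  have gs : ∀ x y, g x y ≠ 0 → s(x, y) ∈ M ∧ x ∈ X ∧ y ∈ X := by
    intro x y hxy
    rcases lt_or_gt_of_ne hxy with h | h
    · have := (gr y x (by rw [ga x y]; omega)).1
      rw [Sym2.eq_swap]; exact ⟨this.1, this.2.2, this.2.1⟩
    · exact (gr x y h).1
  refine ⟨fun x y => f x y + g x y, ?_, ?_, ?_, ?_⟩
  · intro x y; dsimp; rw [fa x y, ga x y]; ring
  · intro x y
    dsimp
    have := g1 x y
    have := f1 x y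
    by_cases h : 0 < g x y
    · have := (gr x y h).2; omega
    · omega
  · intro x y hxy
    by_cases h : g x y = 0
    · exact fs x y (by intro h'; apply hxy; simp [h, h'])
    · exact gs x y h
  · intro x
    have : exc (fun x y => f x y + g x y) x = exc f x + exc g x := by
      simp [exc, Finset.sum_add_distrib]
    rw [this, fe, ge]; ring

lemma menger (M : Finset (Sym2 V)) (X : Finset V)
    (hcut : ∀ Y ⊆ X, Y.Nonempty → Y ≠ X → 2 ≤ (D M Y (X \ Y)).card)
    {x1 x2 : V} (h1 : x1 ∈ X) (h2 : x2 ∈ X) :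
    ∃ H ⊆ M, (∀ v, bd H v = 0) ∧ ∃ R ⊆ X, x1 ∈ R ∧ x2 ∈ R ∧ (∀ x y, s(x, y) ∈ H → x ∈ R) ∧
      ∀ x ∈ R, Rch H x1 x := by
  by_cases hne : x1 = x2
  · subst hne
    refine ⟨∅, by simp, fun v => bd_empty v, {x1}, by simpa using h1, by simp, by simp, by simp, ?_⟩
    intro x hx; simp at hx; rw [hx]; exact Rch.refl _
  obtain ⟨f, fa, f1, fs, fe⟩ := menger_step M X hcut h1 h2 hne 0 (by norm_num) (fun _ _ => 0)
    (fun _ _ => by simp) (by simp) (by simp) (fun x => by simp [exc])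
  obtain ⟨f, fa, f1, fs, fe⟩ := menger_step M X hcut h1 h2 hne _ (by norm_num) f fa f1 fs fe
  have f2 : ∀ x y, f x y = 0 ∨ f x y = 1 ∨ f x y = -1 := by
    intro x y
    have := f1 x y
    have h := f1 y x
    rw [fa x y] at h
    omega
  let S := es (fun x y => f x y ≠ 0)
  have memS : ∀ {x y}, s(x, y) ∈ S ↔ f x y ≠ 0 := by
    intro x y
    exact mem_es (fun x y h => by rw [fa x y]; omega)
  let R : Finset V := Finset.univ.filter (fun x => Rch S x1 x)
  let H := es (fun x y => f x y ≠ 0 ∧ Rch S x1 x)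
  have memH : ∀ {x y}, s(x, y) ∈ H ↔ f x y ≠ 0 ∧ Rch S x1 x := by
    intro x y
    refine mem_es (p := fun x y => f x y ≠ 0 ∧ Rch S x1 x) (fun x y h => ?_)
    refine ⟨by rw [fa x y]; have := h.1; omega, h.2.trans (Rch.single (memS.2 h.1))⟩
  have hx1R : x1 ∈ R := by simp [R]; exact ReflTransGen.refl
  have hRH : ∀ x, Rch S x1 x → Rch H x1 x := by
    intro x hx
    induction hx with
    | refl => exact Rch.refl _
    | tail hb hbc ih => exact ih.trans (Rch.single (memH.2 ⟨memS.1 hbc, hb⟩))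
  refine ⟨H, ?_, ?_, R, ?_, hx1R, ?_, ?_, ?_⟩
  · intro e
    induction e using Sym2.ind with
    | _ x y => intro h; exact (fs x y (memH.1 h).1).1
  · intro v
    by_cases hv : Rch S x1 v
    · have e1 : bd H v = ((exc f v : ℤ) : ZMod 2) := by
        unfold bd exc
        push_cast
        refine Finset.sum_congr rfl fun w _ => ?_
        simp only [memH, hv, and_true]
        rcases f2 v w with h | h | h <;> simp [h]
      rw [e1, fe]
      push_cast
      have : ∀ a : ZMod 2, (0 + 1 + 1) * a = 0 := by decide
      exact this _
    · unfold bd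
      refine Finset.sum_eq_zero fun w _ => ?_
      simp [memH, hv]
  · intro x hx
    simp only [R, Finset.mem_filter, Finset.mem_univ, true_and] at hx
    rcases hx.cases_tail with h | ⟨b, _, hb⟩
    · rw [h]; exact h1
    · exact (fs _ _ (memS.1 hb)).2.2
  · by_contra hx2
    have hsum := sum_exc int_two f fa R
    simp only [fe, ← Finset.mul_sum, Finset.sum_sub_distrib] at hsum
    simp [hx1R, hx2] at hsum
    have : ∑ x ∈ R, ∑ y ∈ Rᶜ, f x y = 0 := by
      refine Finset.sum_eq_zero fun x hx => Finset.sum_eq_zero fun y hy => ?_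
      by_contra hxy
      simp only [R, Finset.mem_compl, Finset.mem_filter, Finset.mem_univ, true_and] at hx hy
      exact hy (hx.trans (Rch.single (memS.2 hxy)))
    omega
  · intro x y h
    simp only [R, Finset.mem_filter, Finset.mem_univ, true_and]
    exact (memH.1 h).2
  · intro x hx
    simp only [R, Finset.mem_filter, Finset.mem_univ, true_and] at hx
    exact hRH x hx

end edgesets
end SC

/-! ## Part 3: Seymour's flow -/
namespace SC
open Relation
open scoped Classical

section seymour
variable [Fintype V]

/-- a `ZMod 3`-flow supported on `M` -/
def Flow3 (M : Finset (Sym2 V)) (φ : V → V → ZMod 3) : Prop :=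
  Anti φ ∧ (∀ x y, φ x y ≠ 0 → s(x, y) ∈ M) ∧ ∀ v, exc φ v = 0

lemma Flow3.add_int {M : Finset (Sym2 V)} {φ : V → V → ZMod 3} (h : Flow3 M φ)
    (c : ZMod 3) {g : V → V → ℤ} (ga : Anti g) (gs : ∀ x y, g x y ≠ 0 → s(x, y) ∈ M)
    (ge : ∀ v, exc g v = 0) : Flow3 M (fun x y => φ x y + c * (g x y : ZMod 3)) := by
  refine ⟨?_, ?_, ?_⟩
  · intro x y; dsimp; rw [h.1 x y, ga x y]; push_cast; ring
  · intro x y hxy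
    by_cases h0 : φ x y = 0
    · apply gs; intro h1; apply hxy; simp [h0, h1]
    · exact h.2.1 x y h0
  · intro v
    have h1 := h.2.2 v
    have h2 := congrArg (Int.cast : ℤ → ZMod 3) (ge v)
    unfold exc at *
    rw [Finset.sum_add_distrib, h1, ← Finset.mul_sum]
    push_cast at h2
    rw [h2]; simp

lemma arc_self {u w : V} (h : u ≠ w) : arc u w u w = 1 := by simp [arc, h]

lemma arc_ne {u w x y : V} (h : s(x, y) ≠ s(u, w)) : arc u w x y = 0 := by
  unfold arc
  have h1 : ¬ (x = u ∧ y = w) := by rintro ⟨rfl, rfl⟩; exact h rfl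
  have h2 : ¬ (x = w ∧ y = u) := by rintro ⟨rfl, rfl⟩; exact h Sym2.eq_swap
  simp [h1, h2]

lemma exc_add (f g : V → V → ℤ) (v : V) : exc (fun x y => f x y + g x y) v = exc f v + exc g v := by
  simp [exc, Finset.sum_add_distrib]

lemma seymour_base (M : Finset (Sym2 V)) (hM : LL M) (K : Finset (Sym2 V)) (hK : K ⊆ M)
    (hconn : ∀ u v, Rch M u v → Rch K u v) (L : Finset (Sym2 V)) : L ⊆ M →
    ∃ φ, Flow3 M φ ∧ ∀ x y, s(x, y) ∈ L → s(x, y) ∉ K → φ x y ≠ 0 := by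
  induction L using Finset.induction_on with
  | empty =>
    intro _
    exact ⟨fun _ _ => 0, ⟨fun _ _ => by simp, by simp, by simp [exc]⟩, by simp⟩
  | insert e L _ ih =>
    intro hL
    obtain ⟨φ, hφ, hn⟩ := ih (fun x hx => hL (Finset.mem_insert_of_mem hx))
    have heM : e ∈ M := hL (Finset.mem_insert_self _ _)
    induction e using Sym2.ind with
    | _ a b =>
    have hab : a ≠ b := by rintro rfl; exact hM _ heM
    by_cases hc : s(a, b) ∈ K ∨ φ a b ≠ 0
    · refine ⟨φ, hφ, ?_⟩
      intro x y hxy hxyK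
      rcases Finset.mem_insert.1 hxy with h | h
      · rcases hc with hc | hc
        · rw [h] at hxyK; exact absurd hc hxyK
        · rw [Sym2.eq_iff] at h
          rcases h with ⟨rfl, rfl⟩ | ⟨rfl, rfl⟩
          · exact hc
          · rw [hφ.1]; exact neg_ne_zero.2 hc
      · exact hn x y h hxyK
    · push Not at hc
      obtain ⟨g, ga, gs, ge⟩ := augE K ((hconn _ _ (Rch.single heM)).symm)
      refine ⟨_, hφ.add_int 1 (g := fun x y => arc a b x y + g x y) ?_ ?_ ?_, ?_⟩
      · intro x y; dsimp; rw [arc_anti a b x y, ga x y]; ring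
      · intro x y h
        by_cases h1 : s(x, y) = s(a, b)
        · rw [h1]; exact heM
        · rw [arc_ne h1, zero_add] at h
          exact hK (gs x y h)
      · intro v
        rw [exc_add, arc_exc, ge]; ring
      · intro x y hxy hxyK
        have g0 : g x y = 0 := by
          by_contra h; exact hxyK (gs _ _ h)
        dsimp
        rw [g0]
        by_cases h1 : s(x, y) = s(a, b)
        · rw [Sym2.eq_iff] at h1
          rcases h1 with ⟨rfl, rfl⟩ | ⟨rfl, rfl⟩
          · rw [hc.2, arc_self hab]; simp
          · rw [hφ.1, hc.2, arc_anti, arc_self hab]; simp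
        · rw [arc_ne h1]
          have := hn x y ((Finset.mem_insert.1 hxy).resolve_left h1) hxyK
          simpa using this

/-- the conclusion of the inductive claim -/
def SClaim (M A' : Finset (Sym2 V)) (A : Finset V) : Prop :=
  ∃ Z ⊆ M, (∀ v, bd Z v = 0) ∧ (∀ x y, s(x, y) ∈ Z → x ∉ A) ∧
    ∃ φ, Flow3 M φ ∧ ∀ x y, s(x, y) ∈ M → s(x, y) ∉ Z → s(x, y) ∉ A' → φ x y ≠ 0

lemma exists_minX (M : Finset (Sym2 V)) (A : Finset V) (hA : A ≠ Finset.univ) :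
    ∃ X ⊆ Aᶜ, X.Nonempty ∧ (D M X (A ∪ X)ᶜ).card ≤ 1 ∧
      ∀ Y ⊆ X, Y.Nonempty → Y ≠ X → 2 ≤ (D M Y (X \ Y)).card := by
  let F := (Finset.powerset Aᶜ).filter (fun X => X.Nonempty ∧ (D M X (A ∪ X)ᶜ).card ≤ 1)
  have hF : F.Nonempty := by
    refine ⟨Aᶜ, ?_⟩
    simp only [F, Finset.mem_filter, Finset.mem_powerset]
    refine ⟨subset_rfl, ?_, ?_⟩
    · rw [Finset.nonempty_iff_ne_empty]; simpa using hA
    · simp [D]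
  obtain ⟨X, hX, hmin⟩ := Finset.exists_min_image F Finset.card hF
  simp only [F, Finset.mem_filter, Finset.mem_powerset] at hX hmin
  refine ⟨X, hX.1, hX.2.1, hX.2.2, ?_⟩
  intro Y hYX hY hYne
  have key : ∀ Y ⊆ X, Y.Nonempty → Y ≠ X →
      2 ≤ (D M Y (X \ Y)).card + (D M Y (A ∪ X)ᶜ).card := by
    intro Y hYX hY hYne
    have h1 : ¬ (D M Y (A ∪ Y)ᶜ).card ≤ 1 := by
      intro h
      have := hmin Y ⟨hYX.trans hX.1, hY, h⟩
      have := Finset.card_lt_card (Finset.ssubset_iff_subset_ne.2 ⟨hYX, hYne⟩)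
      omega
    have h2 : (A ∪ Y)ᶜ = (X \ Y) ∪ (A ∪ X)ᶜ := by
      ext z
      have h3 : z ∈ Y → z ∈ X := fun h => hYX h
      have h4 : z ∈ X → z ∉ A := fun h => by simpa using hX.1 h
      simp only [Finset.mem_compl, Finset.mem_union, Finset.mem_sdiff]
      tauto
    rw [h2, D_union_right] at h1
    · omega
    · rw [Finset.disjoint_left]
      intro z hz hz'
      simp only [Finset.mem_compl, Finset.mem_union, Finset.mem_sdiff] at hz hz'
      tauto
  have k1 := key Y hYX hY hYne
  have k2 := key (X \ Y) Finset.sdiff_subset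
    (by
      rw [Finset.sdiff_nonempty]; intro h
      exact hYne (Finset.Subset.antisymm hYX h))
    (by
      intro h
      obtain ⟨y, hy⟩ := hY
      have : y ∈ X \ Y := by rw [h]; exact hYX hy
      exact (Finset.mem_sdiff.1 this).2 hy)
  rw [Finset.sdiff_sdiff_eq_self hYX, D_swap M (X \ Y) Y] at k2
  have k3 := D_union_left M (A ∪ X)ᶜ (Y := Y) (Z := X \ Y) Finset.disjoint_sdiff
  rw [Finset.union_sdiff_of_subset hYX] at k3
  omega

lemma conn_ext {M K K' : Finset (Sym2 V)} {A R : Finset V} (hKK : K ⊆ K') (hKM : K' ⊆ M)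
    (hconn : ∀ u ∈ A, ∀ v ∈ A, Rch M u v → Rch K u v) {a : V} (ha : a ∈ A)
    (hR : ∀ x ∈ R, Rch K' a x) :
    ∀ u ∈ A ∪ R, ∀ v ∈ A ∪ R, Rch M u v → Rch K' u v := by
  have key : ∀ u ∈ A ∪ R, Rch M a u → Rch K' a u := by
    intro u hu h
    rcases Finset.mem_union.1 hu with hu | hu
    · exact (hconn a ha u hu h).mono hKK
    · exact hR u hu
  intro u hu v hv h
  by_cases hau : Rch M a u
  · exact (key u hu hau).symm.trans (key v hv (hau.trans h))
  · have huA : u ∈ A := by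
      rcases Finset.mem_union.1 hu with hu | hu
      · exact hu
      · exact absurd ((hR u hu).mono hKM) hau
    have hvA : v ∈ A := by
      rcases Finset.mem_union.1 hv with hv | hv
      · exact hv
      · exact absurd (((hR v hv).mono hKM).trans h.symm) hau
    exact (hconn u huA v hvA h).mono hKK

lemma seymour_two {M : Finset (Sym2 V)} (hM : LL M) {A : Finset V} {K : Finset (Sym2 V)}
    (hKM : K ⊆ M) (hKA : ∀ x y, s(x, y) ∈ K → x ∈ A)
    (hconn : ∀ u ∈ A, ∀ v ∈ A, Rch M u v → Rch K u v)
    {X : Finset V} (hXA : X ⊆ Aᶜ) 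
    (hcut : ∀ Y ⊆ X, Y.Nonempty → Y ≠ X → 2 ≤ (D M Y (X \ Y)).card)
    (h2 : 2 ≤ (D M X A).card)
    (ih : ∀ (A' : Finset V) (K' : Finset (Sym2 V)), A'ᶜ.card < Aᶜ.card → K' ⊆ M →
      (∀ x y, s(x, y) ∈ K' → x ∈ A') → (∀ u ∈ A', ∀ v ∈ A', Rch M u v → Rch K' u v) →
      SClaim M K' A') : SClaim M K A := by
  obtain ⟨⟨x1, a1⟩, h1, ⟨x2, a2⟩, h2, hne⟩ := Finset.one_lt_card.1 h2
  rw [mem_D] at h1 h2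
  dsimp at h1 h2
  obtain ⟨⟨hx1, ha1⟩, he1⟩ := h1
  obtain ⟨⟨hx2, ha2⟩, he2⟩ := h2
  have hXnA : ∀ x ∈ X, x ∉ A := fun x hx => by simpa using hXA hx
  obtain ⟨H, hHM, hHb, R, hRX, hx1R, hx2R, hHR, hRH⟩ := menger M X hcut hx1 hx2
  have hHnA : ∀ x y, s(x, y) ∈ H → x ∉ A := fun x y h => hXnA x (hRX (hHR x y h))
  let K' := K ∪ H ∪ {s(x1, a1), s(x2, a2)}
  have hKK : K ⊆ K' := by intro e he; simp [K', he]
  have hHK : H ⊆ K' := by intro e he; simp [K', he]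
  have hK'M : K' ⊆ M := by
    intro e he
    simp only [K', Finset.mem_union, Finset.mem_insert, Finset.mem_singleton] at he
    rcases he with (he | he) | rfl | rfl
    · exact hKM he
    · exact hHM he
    · exact he1
    · exact he2
  have hK'1 : s(x1, a1) ∈ K' := by simp [K']
  have hRch1 : ∀ x ∈ R, Rch K' a1 x := fun x hx =>
    ((Rch.single hK'1).symm).trans ((hRH x hx).mono hHK)
  have hsub : (A ∪ R)ᶜ.card < Aᶜ.card := by
    apply Finset.card_lt_card
    rw [Finset.ssubset_iff_of_subset]
    · exact ⟨x1, by simpa using hXnA x1 hx1, by simp [hx1R]⟩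
    · intro z hz; simp at hz ⊢; exact hz.1
  obtain ⟨Z', hZM, hZb, hZA, φ', hφ, hn⟩ := ih (A ∪ R) K' hsub hK'M
    (by
      intro x y hxy
      simp only [K', Finset.mem_union, Finset.mem_insert, Finset.mem_singleton, Sym2.eq_iff]
        at hxy ⊢
      rcases hxy with (h | h) | (⟨rfl, rfl⟩ | ⟨rfl, rfl⟩) | (⟨rfl, rfl⟩ | ⟨rfl, rfl⟩)
      · exact Or.inl (hKA _ _ h)
      · exact Or.inr (hHR _ _ h)
      · exact Or.inr hx1R
      · exact Or.inl ha1
      · exact Or.inr hx2R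
      · exact Or.inl ha2)
    (conn_ext hKK hK'M hconn ha1 hRch1)
  obtain ⟨gH, gHa, gHs, gHe⟩ := augE H (hRH x2 hx2R)
  have hRK : Rch K a2 a1 := by
    apply hconn a2 ha2 a1 ha1
    have : Rch M a1 a2 :=
      ((Rch.single he1).symm).trans (((hRH x2 hx2R).mono hHM).trans (Rch.single he2))
    exact this.symm
  obtain ⟨gK, gKa, gKs, gKe⟩ := augE K hRK
  have hne1 : a1 ≠ x1 := by rintro rfl; exact hXnA _ hx1 ha1
  have hne2 : x2 ≠ a2 := by rintro rfl; exact hXnA _ hx2 ha2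
  have hs : s(a1, x1) ≠ s(x2, a2) := by
    intro h
    rw [Sym2.eq_iff] at h
    rcases h with ⟨rfl, rfl⟩ | ⟨rfl, rfl⟩
    · exact hXnA _ hx2 ha1
    · exact hne rfl
  have hc : ∃ c : ZMod 3, φ' a1 x1 + c ≠ 0 ∧ φ' x2 a2 + c ≠ 0 := by
    have : ∀ p q : ZMod 3, ∃ c, p + c ≠ 0 ∧ q + c ≠ 0 := by decide
    exact this _ _
  obtain ⟨c, hc1, hc2⟩ := hc
  let ψ : V → V → ℤ := fun x y => (arc a1 x1 x y + arc x2 a2 x y) + (gH x y + gK x y)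
  have ψa : Anti ψ := by
    intro x y
    simp only [ψ]
    rw [arc_anti a1 x1 x y, arc_anti x2 a2 x y, gHa x y, gKa x y]; ring
  refine ⟨Z' ∪ H, Finset.union_subset hZM hHM, ?_, ?_, _, hφ.add_int c (g := ψ) ψa ?_ ?_, ?_⟩
  · intro v
    rw [bd_union, hZb, hHb, add_zero]
    rw [Finset.disjoint_left]
    intro e
    induction e using Sym2.ind with
    | _ x y =>
      intro hz hh
      exact hZA x y hz (Finset.mem_union_right _ (hHR x y hh))
  · intro x y h
    rcases Finset.mem_union.1 h with h | h
    · intro hx; exact hZA x y h (Finset.mem_union_left _ hx)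
    · exact hHnA x y h
  · intro x y h
    by_contra hcon
    apply h
    have z1 : arc a1 x1 x y = 0 := arc_ne (by
      intro h'; apply hcon; rw [h', Sym2.eq_swap]; exact he1)
    have z2 : arc x2 a2 x y = 0 := arc_ne (by
      intro h'; apply hcon; rw [h']; exact he2)
    have z3 : gH x y = 0 := by by_contra h'; exact hcon (hHM (gHs _ _ h'))
    have z4 : gK x y = 0 := by by_contra h'; exact hcon (hKM (gKs _ _ h'))
    simp only [ψ, z1, z2, z3, z4]; rfl
  · intro v
    simp only [ψ]
    rw [exc_add, exc_add, exc_add, arc_exc, arc_exc, gHe, gKe]; ring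
  · intro x y hxyM hxyZ hxyK
    rw [Finset.mem_union, not_or] at hxyZ
    have z3 : gH x y = 0 := by by_contra h'; exact hxyZ.2 (gHs _ _ h')
    have z4 : gK x y = 0 := by by_contra h'; exact hxyK (gKs _ _ h')
    simp only [ψ, z3, z4]
    by_cases h1 : s(x, y) = s(a1, x1)
    · have z2 : arc x2 a2 x y = 0 := arc_ne (by rw [h1]; exact hs)
      rw [z2]
      rw [Sym2.eq_iff] at h1
      rcases h1 with ⟨rfl, rfl⟩ | ⟨rfl, rfl⟩
      · rw [arc_self hne1]; simpa using hc1
      · rw [hφ.1, arc_anti, arc_self hne1]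
        intro h; apply hc1
        push_cast at h
        linear_combination -h
    · have z1 : arc a1 x1 x y = 0 := arc_ne h1
      rw [z1]
      by_cases h2 : s(x, y) = s(x2, a2)
      · rw [Sym2.eq_iff] at h2
        rcases h2 with ⟨rfl, rfl⟩ | ⟨rfl, rfl⟩
        · rw [arc_self hne2]; simpa using hc2
        · rw [hφ.1, arc_anti, arc_self hne2]
          intro h; apply hc2
          push_cast at h
          linear_combination -h
      · have z2 : arc x2 a2 x y = 0 := arc_ne h2
        rw [z2]
        have : φ' x y ≠ 0 := by
          apply hn x y hxyM hxyZ.1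
          simp only [K', Finset.mem_union, Finset.mem_insert, Finset.mem_singleton]
          rw [Sym2.eq_swap (a := a1)] at h1
          tauto
        simpa using this

lemma card_compl_lt {A : Finset V} {x : V} (hx : x ∉ A) : (A ∪ {x})ᶜ.card < Aᶜ.card := by
  apply Finset.card_lt_card
  rw [Finset.ssubset_iff_of_subset]
  · exact ⟨x, by simpa using hx, by simp⟩
  · intro z hz; simp at hz ⊢; exact hz.2

lemma seymour_one {M : Finset (Sym2 V)} (hM : LL M) {A : Finset V} {K : Finset (Sym2 V)}
    (hKM : K ⊆ M) (hKA : ∀ x y, s(x, y) ∈ K → x ∈ A)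
    (hconn : ∀ u ∈ A, ∀ v ∈ A, Rch M u v → Rch K u v)
    {X : Finset V} (hXA : X ⊆ Aᶜ) (hXc : Xᶜ = A ∪ (A ∪ X)ᶜ)
    (h1 : (D M X A).card = 1) (h2 : (D M X (A ∪ X)ᶜ).card = 1)
    (ih : ∀ (A' : Finset V) (K' : Finset (Sym2 V)), A'ᶜ.card < Aᶜ.card → K' ⊆ M →
      (∀ x y, s(x, y) ∈ K' → x ∈ A') → (∀ u ∈ A', ∀ v ∈ A', Rch M u v → Rch K' u v) →
      SClaim M K' A') : SClaim M K A := by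
  obtain ⟨⟨x, a⟩, hxa⟩ := Finset.card_eq_one.1 h1
  obtain ⟨⟨p, q⟩, hpq⟩ := Finset.card_eq_one.1 h2
  have hDM : D M X Xᶜ = {(x, a), (p, q)} := by
    have : D M X Xᶜ = D M X A ∪ D M X (A ∪ X)ᶜ := by
      rw [hXc]; ext z; simp only [mem_D, Finset.mem_union]; tauto
    rw [this, hxa, hpq]; rfl
  have hXnA : ∀ x ∈ X, x ∉ A := fun x hx => by simpa using hXA hx
  have m1 : (x, a) ∈ D M X A := by rw [hxa]; simp
  have m2 : (p, q) ∈ D M X (A ∪ X)ᶜ := by rw [hpq]; simp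
  rw [mem_D] at m1 m2
  obtain ⟨⟨hx, ha⟩, he⟩ := m1
  obtain ⟨⟨hp, hq⟩, he'⟩ := m2
  dsimp at hx ha he hp hq he'
  have hK'M : K ∪ {s(x, a)} ⊆ M := by
    apply Finset.union_subset hKM; simpa using he
  have hK'A : ∀ u v, s(u, v) ∈ K ∪ {s(x, a)} → u ∈ A ∪ {x} := by
    intro u v huv
    simp only [Finset.mem_union, Finset.mem_singleton, Sym2.eq_iff] at huv ⊢
    rcases huv with h | ⟨rfl, rfl⟩ | ⟨rfl, rfl⟩
    · exact Or.inl (hKA _ _ h)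
    · exact Or.inr rfl
    · exact Or.inl ha
  obtain ⟨Z, hZM, hZb, hZA, φ, hφ, hn⟩ := ih (A ∪ {x}) (K ∪ {s(x, a)})
    (card_compl_lt (hXnA x hx)) hK'M hK'A
    (conn_ext Finset.subset_union_left hK'M hconn ha (by
      intro z hz; simp at hz; subst hz
      exact (Rch.single (by simp)).symm))
  refine ⟨Z, hZM, hZb, fun u v h hu => hZA u v h (Finset.mem_union_left _ hu), φ, hφ, ?_⟩
  have hxne : (x, a) ≠ (p, q) := by
    intro h
    simp only [Prod.mk.injEq] at h
    rw [← h.2] at hq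
    simp [ha] at hq
  have hpqZ : s(p, q) ∉ Z := by
    intro hz
    have hev := cut_even (hM.mono hZM) hZb X
    have : D Z X Xᶜ = {(p, q)} := by
      ext z
      rw [Finset.mem_singleton]
      constructor
      · intro hzz
        have hz2 : z ∈ D M X Xᶜ := by
          rw [mem_D] at hzz ⊢; exact ⟨hzz.1, hZM hzz.2⟩
        rw [hDM] at hz2
        simp only [Finset.mem_insert, Finset.mem_singleton] at hz2
        rcases hz2 with rfl | rfl
        · rw [mem_D] at hzz
          exact absurd (by simp) (hZA _ _ hzz.2)
        · rfl
      · rintro rfl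
        rw [mem_D]
        refine ⟨⟨hp, ?_⟩, hz⟩
        simp at hq ⊢; exact hq.2
    rw [this] at hev
    simp at hev
  have hpqn : φ p q ≠ 0 := by
    apply hn p q he' hpqZ
    intro h
    rw [Sym2.eq_swap (a := p)] at h
    have := hK'A _ _ h
    simp at hq this
    rcases this with h | h
    · rw [h] at hq; exact hq.2 hx
    · exact hq.1 h
  have hxan : φ x a ≠ 0 := by
    have hs := sum_exc zmod3_two φ hφ.1 X
    simp only [hφ.2.2, Finset.sum_const_zero] at hs
    rw [← Finset.sum_product'] at hs
    have : ∑ z ∈ X ×ˢ Xᶜ, φ z.1 z.2 = ∑ z ∈ D M X Xᶜ, φ z.1 z.2 := by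
      symm
      apply Finset.sum_subset
      · exact Finset.filter_subset _ _
      · intro z hz hz'
        by_contra h
        apply hz'
        rw [mem_D]
        exact ⟨Finset.mem_product.1 hz, hφ.2.1 _ _ h⟩
    rw [this, hDM, Finset.sum_pair hxne] at hs
    intro h
    rw [h, zero_add] at hs
    exact hpqn hs.symm
  intro u v huv huvZ huvK
  by_cases h : s(u, v) = s(x, a)
  · rw [Sym2.eq_iff] at h
    rcases h with ⟨rfl, rfl⟩ | ⟨rfl, rfl⟩
    · exact hxan
    · rw [hφ.1]; exact neg_ne_zero.2 hxan
  · apply hn u v huv huvZ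
    simp [h, huvK]

lemma seymour_zero {M : Finset (Sym2 V)} {A : Finset V} {K : Finset (Sym2 V)}
    (hKM : K ⊆ M) (hKA : ∀ x y, s(x, y) ∈ K → x ∈ A)
    (hconn : ∀ u ∈ A, ∀ v ∈ A, Rch M u v → Rch K u v)
    {X : Finset V} (hXA : X ⊆ Aᶜ) (hX : X.Nonempty)
    (h1 : (D M X Xᶜ).card = 0) 
    (ih : ∀ (A' : Finset V) (K' : Finset (Sym2 V)), A'ᶜ.card < Aᶜ.card → K' ⊆ M →
      (∀ x y, s(x, y) ∈ K' → x ∈ A') → (∀ u ∈ A', ∀ v ∈ A', Rch M u v → Rch K' u v) →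
      SClaim M K' A') : SClaim M K A := by
  obtain ⟨x, hx⟩ := hX
  have hXnA : ∀ x ∈ X, x ∉ A := fun x hx => by simpa using hXA hx
  have hno : ∀ u, Rch M x u → u ∈ X := by
    intro u hu
    induction hu with
    | refl => exact hx
    | tail _ hbc ih' =>
      rename_i b c _
      by_contra hc
      rw [Finset.card_eq_zero] at h1
      have : (b, c) ∈ D M X Xᶜ := by
        rw [mem_D]; exact ⟨⟨ih', by simpa using hc⟩, hbc⟩
      rw [h1] at this
      simp at this
  obtain ⟨Z, hZM, hZb, hZA, φ, hφ, hn⟩ := ih (A ∪ {x}) K (card_compl_lt (hXnA x hx)) hKM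
    (fun u v h => Finset.mem_union_left _ (hKA u v h)) (by
      intro u hu v hv huv
      simp only [Finset.mem_union, Finset.mem_singleton] at hu hv
      rcases hu with hu | rfl
      · rcases hv with hv | rfl
        · exact hconn u hu v hv huv
        · exact absurd hu (hXnA _ (hno _ huv.symm))
      · rcases hv with hv | rfl
        · exact absurd hv (hXnA _ (hno _ huv))
        · exact Rch.refl _)
  exact ⟨Z, hZM, hZb, fun u v h hu => hZA u v h (Finset.mem_union_left _ hu), φ, hφ, hn⟩

lemma seymour_aux (M : Finset (Sym2 V)) (hM : LL M) (hb : ∀ X, (D M X Xᶜ).card ≠ 1) (n : ℕ) :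
    ∀ (A : Finset V) (K : Finset (Sym2 V)), Aᶜ.card = n → K ⊆ M →
      (∀ x y, s(x, y) ∈ K → x ∈ A) → (∀ u ∈ A, ∀ v ∈ A, Rch M u v → Rch K u v) →
      SClaim M K A := by
  induction n using Nat.strong_induction_on with
  | _ n IH =>
  intro A K hn hKM hKA hconn
  have ih : ∀ (A' : Finset V) (K' : Finset (Sym2 V)), A'ᶜ.card < Aᶜ.card → K' ⊆ M →
      (∀ x y, s(x, y) ∈ K' → x ∈ A') → (∀ u ∈ A', ∀ v ∈ A', Rch M u v → Rch K' u v) →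
      SClaim M K' A' := fun A' K' h => IH _ (hn ▸ h) A' K' rfl
  by_cases hA : A = Finset.univ
  · subst hA
    obtain ⟨φ, hφ, h⟩ := seymour_base M hM K hKM (fun u v => hconn u (by simp) v (by simp)) M
      subset_rfl
    exact ⟨∅, by simp, fun v => bd_empty v, by simp, φ, hφ, fun x y h1 _ h2 => h x y h1 h2⟩
  · obtain ⟨X, hXA, hX, hout, hcut⟩ := exists_minX M A hA
    have hXc : Xᶜ = A ∪ (A ∪ X)ᶜ := by
      ext z
      have h4 : z ∈ X → z ∉ A := fun h => by simpa using hXA h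
      simp only [Finset.mem_compl, Finset.mem_union]
      tauto
    have hsum : (D M X Xᶜ).card = (D M X A).card + (D M X (A ∪ X)ᶜ).card := by
      conv_lhs => rw [hXc]
      apply D_union_right
      rw [Finset.disjoint_left]
      intro z hz hz'
      simp [hz] at hz'
    have := hb X
    by_cases h2 : 2 ≤ (D M X A).card
    · exact seymour_two hM hKM hKA hconn hXA hcut h2 ih
    by_cases h1 : (D M X A).card = 1
    · exact seymour_one hM hKM hKA hconn hXA hXc h1 (by omega) ih
    · exact seymour_zero hKM hKA hconn hXA hX (by omega) ih

/-- every edge of `M` is in an even subset of `M` -/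
def Bless (M : Finset (Sym2 V)) : Prop := ∀ e ∈ M, ∃ Y ⊆ M, (∀ v, bd Y v = 0) ∧ e ∈ Y

lemma Bless.cut {M : Finset (Sym2 V)} (hM : LL M) (h : Bless M) (X : Finset V) :
    (D M X Xᶜ).card ≠ 1 := by
  intro h1
  obtain ⟨⟨x, y⟩, hxy⟩ := Finset.card_eq_one.1 h1
  have m1 : (x, y) ∈ D M X Xᶜ := by rw [hxy]; simp
  obtain ⟨Y, hY, hYb, he⟩ := h _ (mem_D.1 m1).2
  have hev := cut_even (hM.mono hY) hYb X
  have : D Y X Xᶜ = {(x, y)} := by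
    apply Finset.Subset.antisymm
    · rw [← hxy]
      intro z hz
      rw [mem_D] at hz ⊢; exact ⟨hz.1, hY hz.2⟩
    · rw [Finset.singleton_subset_iff, mem_D]
      exact ⟨(mem_D.1 m1).1, he⟩
  rw [this] at hev
  simp at hev

theorem seymour (M : Finset (Sym2 V)) (hM : LL M) (h : Bless M) :
    ∃ Z ⊆ M, (∀ v, bd Z v = 0) ∧ ∃ φ, Flow3 M φ ∧
      ∀ x y, s(x, y) ∈ M → s(x, y) ∉ Z → φ x y ≠ 0 := by
  obtain ⟨Z, hZM, hZb, -, φ, hφ, hn⟩ := seymour_aux M hM (h.cut hM) _ ∅ ∅ rfl (by simp) (by simp)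
    (by simp)
  exact ⟨Z, hZM, hZb, φ, hφ, fun x y h1 h2 => hn x y h1 h2 (by simp)⟩

end seymour
end SC

/-! ## Part 4: covers by even subgraphs -/
namespace SC
open Relation
open scoped Classical

section covers
variable [Fintype V]

/-- `A` is an even edge set -/
def Ev (A : Finset (Sym2 V)) : Prop := ∀ v, bd A v = 0

lemma Ev.symmDiff {A B : Finset (Sym2 V)} (hA : Ev A) (hB : Ev B) : Ev (symmDiff A B) := by
  intro v; rw [bd_symmDiff, hA, hB, add_zero]

lemma ev_odd {f : V → V → ℤ} (fa : Anti f) (fe : ∀ v, exc f v = 0) :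
    Ev (es (fun x y => Odd (f x y))) := by
  have mem : ∀ {x y}, s(x, y) ∈ es (fun x y => Odd (f x y)) ↔ Odd (f x y) := by
    intro x y
    exact mem_es (p := fun x y => Odd (f x y)) (fun x y h => by rw [fa x y]; exact h.neg)
  intro v
  have e1 : bd (es (fun x y => Odd (f x y))) v = ((exc f v : ℤ) : ZMod 2) := by
    unfold bd exc
    push_cast
    refine Finset.sum_congr rfl fun w _ => ?_
    simp only [mem]
    split_ifs with h
    · exact ((ZMod.intCast_eq_one_iff_odd).2 h).symm
    · rw [Int.not_odd_iff_even] at h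
      exact ((ZMod.intCast_eq_zero_iff_even).2 h).symm
  rw [e1, fe]; simp

lemma eulerian {A : Finset (Sym2 V)} (hA : LL A) (h : Ev A) :
    ∃ o : V → V → ℤ, Anti o ∧ (∀ x y, |o x y| < 2) ∧ (∀ x y, s(x, y) ∈ A ↔ Odd (o x y)) ∧
      ∀ v, exc o v = 0 := by
  let ι := Fintype.equivFin V
  let f : V → V → ℤ := fun x y => if s(x, y) ∈ A then (if ι x < ι y then 1 else -1) else 0
  have fodd : ∀ x y, s(x, y) ∈ A ↔ Odd (f x y) := by
    intro x y
    simp only [f]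
    split_ifs with h1 h2
    · simp [h1]
    · simp [h1]
    · simp [h1]
  have fa : Anti f := by
    intro x y
    simp only [f, Sym2.eq_swap (a := y)]
    split_ifs with h1 h2 h3 h4
    · exact absurd h2 (lt_asymm h3)
    · rfl
    · rfl
    · exfalso
      have : x = y := ι.injective (le_antisymm (not_lt.1 h2) (not_lt.1 h4))
      subst this; exact hA _ h1
    · rfl
  obtain ⟨o, oa, ob, od, oe⟩ := lift 2 (by norm_num) f fa
    (by intro x y; simp only [f]; split_ifs <;> simp)
    (by
      intro v
      have e1 : ((exc f v : ℤ) : ZMod 2) = 0 := by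
        rw [← h v]
        unfold bd exc
        push_cast
        refine Finset.sum_congr rfl fun w _ => ?_
        simp only [f]
        split_ifs <;> simp
      exact (ZMod.intCast_zmod_eq_zero_iff_dvd _ 2).1 e1)
  refine ⟨o, oa, ob, ?_, oe⟩
  intro x y
  rw [fodd x y]
  obtain ⟨k, hk⟩ := od x y
  have : o x y = f x y + 2 * k := by omega
  rw [this]
  constructor
  · intro h; exact h.add_even (even_two_mul k)
  · intro h
    have := h.sub_even (even_two_mul k)
    simpa using this

/-- support of a flow -/
noncomputable def supp (φ : V → V → ZMod 3) : Finset (Sym2 V) := es (fun x y => φ x y ≠ 0)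

lemma mem_supp {M : Finset (Sym2 V)} {φ : V → V → ZMod 3} (h : Flow3 M φ) {x y : V} :
    s(x, y) ∈ supp φ ↔ φ x y ≠ 0 :=
  mem_es (p := fun x y => φ x y ≠ 0) (fun x y hx => by rw [h.1 x y]; exact neg_ne_zero.2 hx)

lemma supp_sub {M : Finset (Sym2 V)} {φ : V → V → ZMod 3} (h : Flow3 M φ) : supp φ ⊆ M := by
  intro e
  induction e using Sym2.ind with
  | _ x y => intro he; exact h.2.1 x y ((mem_supp h).1 he)

/-- a 3-flow splits into two even sets covering the support -/
lemma flow_split {M : Finset (Sym2 V)} (hM : LL M) {φ : V → V → ZMod 3} (h : Flow3 M φ) :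
    ∃ W W', Ev W ∧ Ev W' ∧ W ∪ W' = supp φ := by
  have hneg : ∀ a : ZMod 3, (-a).valMinAbs = - a.valMinAbs := by decide
  have hlt : ∀ a : ZMod 3, |a.valMinAbs| < 3 := by decide
  obtain ⟨f, fa, fb, fd, fe⟩ := lift 3 (by norm_num) (fun x y => (φ x y).valMinAbs)
    (fun x y => by dsimp; rw [h.1 x y, hneg]) (fun x y => hlt _)
    (by
      intro v
      refine (ZMod.intCast_zmod_eq_zero_iff_dvd _ 3).1 ?_
      rw [← h.2.2 v]
      unfold exc
      push_cast
      simp)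
  have f3 : ∀ x y, ((f x y : ℤ) : ZMod 3) = φ x y := by
    intro x y
    have := (ZMod.intCast_zmod_eq_zero_iff_dvd _ 3).2 (fd x y)
    push_cast at this
    rw [sub_eq_zero] at this
    rw [this]
  have f0 : ∀ x y, φ x y ≠ 0 ↔ f x y ≠ 0 := by
    intro x y
    rw [← f3, not_iff_not]
    constructor
    · intro h'
      have h1 := (ZMod.intCast_zmod_eq_zero_iff_dvd _ 3).1 h'
      have h2 := abs_lt.1 (fb x y)
      push_cast at h1
      omega
    · intro h'; rw [h']; simp
  let W := es (fun x y => Odd (f x y))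
  have memW : ∀ {x y}, s(x, y) ∈ W ↔ Odd (f x y) := by
    intro x y
    exact mem_es (p := fun x y => Odd (f x y)) (fun x y h => by rw [fa x y]; exact h.neg)
  have hWM : W ⊆ M := by
    intro e
    induction e using Sym2.ind with
    | _ x y =>
      intro he
      have h1 := memW.1 he
      apply h.2.1
      rw [f0]
      intro h2; rw [h2] at h1; simp at h1
  obtain ⟨o, oa, ob, oA, oe⟩ := eulerian (hM.mono hWM) (ev_odd fa fe)
  have hev : ∀ x y, ∃ k, f x y = o x y + 2 * k := by
    intro x y
    have h1 := memW (x := x) (y := y)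
    have h2 : s(x, y) ∈ W ↔ _ := oA x y
    rw [h1] at h2
    refine ⟨(f x y - o x y) / 2, ?_⟩
    have : Even (f x y - o x y) := by
      rw [Int.even_sub, ← Int.not_odd_iff_even, ← Int.not_odd_iff_even, h2]
    obtain ⟨r, hr⟩ := this
    omega
  choose g hg using hev
  have ga : Anti g := by
    intro x y
    have h1 := hg x y
    have h2 := hg y x
    rw [fa x y, oa x y] at h2
    omega
  have ge : ∀ v, exc g v = 0 := by
    intro v
    have h1 : exc f v = exc o v + 2 * exc g v := by
      unfold exc
      rw [Finset.mul_sum, ← Finset.sum_add_distrib]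
      exact Finset.sum_congr rfl fun w _ => hg v w
    rw [fe, oe] at h1
    omega
  refine ⟨W, es (fun x y => Odd (g x y)), ev_odd fa fe, ev_odd ga ge, ?_⟩
  ext e
  induction e using Sym2.ind with
  | _ x y =>
  rw [Finset.mem_union, mem_supp h, memW,
    mem_es (p := fun x y => Odd (g x y)) (fun x y h => by rw [ga x y]; exact h.neg), f0]
  have h1 := hg x y
  have h2 := abs_lt.1 (fb x y)
  have h3 := abs_lt.1 (ob x y)
  have h4 : Odd (f x y) ↔ _ := (memW (x := x) (y := y)).symm.trans (oA x y)
  simp only [Int.odd_iff] at *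
  omega

/-- a valid pair -/
def Valid (M Z : Finset (Sym2 V)) (φ : V → V → ZMod 3) : Prop :=
  Z ⊆ M ∧ Ev Z ∧ Flow3 M φ ∧ ∀ x y, s(x, y) ∈ M → s(x, y) ∉ Z → φ x y ≠ 0

lemma exists_best (M : Finset (Sym2 V)) (hM : LL M) (h : Bless M) :
    ∃ Z φ, Valid M Z φ ∧ ∀ Z' φ', Valid M Z' φ' →
      3 * Z.card + 4 * (supp φ).card ≤ 3 * Z'.card + 4 * (supp φ').card := by
  obtain ⟨Z, h1, h2, φ, h3, h4⟩ := seymour M hM h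
  have hex : ∃ n, ∃ Z φ, Valid M Z φ ∧ 3 * Z.card + 4 * (supp φ).card = n :=
    ⟨_, Z, φ, ⟨h1, h2, h3, h4⟩, rfl⟩
  obtain ⟨Z, φ, hv, hn⟩ := Nat.find_spec hex
  refine ⟨Z, φ, hv, fun Z' φ' h' => ?_⟩
  rw [hn]
  exact Nat.find_min' hex ⟨Z', φ', h', rfl⟩

lemma card_inter_sum {α : Type*} [DecidableEq α] (A Y : Finset α) :
    (A ∩ Y).card = ∑ e ∈ A, if e ∈ Y then 1 else 0 := by
  rw [← Finset.filter_mem_eq_inter, Finset.card_filter]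

lemma card_symmDiff_add {α : Type*} [DecidableEq α] (A Y : Finset α) :
    (symmDiff A Y).card + 2 * (A ∩ Y).card = A.card + Y.card := by
  have h1 := Finset.card_sdiff_add_card_inter A Y
  have h2 := Finset.card_sdiff_add_card_inter Y A
  rw [Finset.inter_comm] at h2
  have : symmDiff A Y = (A \ Y) ∪ (Y \ A) := rfl
  rw [this, Finset.card_union_of_disjoint disjoint_sdiff_sdiff]
  omega

lemma three_sum {α : Type*} [DecidableEq α] (A W W' : Finset α) (h : A ⊆ W ∪ W') :
    (A ∩ W).card + (A ∩ W').card + (A ∩ symmDiff W W').card = 2 * A.card := by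
  rw [card_inter_sum, card_inter_sum, card_inter_sum, ← Finset.sum_add_distrib,
    ← Finset.sum_add_distrib, mul_comm, ← smul_eq_mul, ← Finset.sum_const]
  refine Finset.sum_congr rfl fun e he => ?_
  have := h he
  rw [Finset.mem_union] at this
  simp only [Finset.mem_symmDiff]
  by_cases h1 : e ∈ W <;> by_cases h2 : e ∈ W' <;> simp_all

lemma seven_sum {α : Type*} [DecidableEq α] (A X Y Z : Finset α) (h : A ⊆ X ∪ Y ∪ Z) :
    (A ∩ X).card + (A ∩ Y).card + (A ∩ Z).card + (A ∩ symmDiff X Y).card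
      + (A ∩ symmDiff X Z).card + (A ∩ symmDiff Y Z).card
      + (A ∩ symmDiff (symmDiff X Y) Z).card = 4 * A.card := by
  simp only [card_inter_sum]
  simp only [← Finset.sum_add_distrib]
  rw [mul_comm, ← smul_eq_mul, ← Finset.sum_const]
  refine Finset.sum_congr rfl fun e he => ?_
  have := h he
  simp only [Finset.mem_union] at this
  simp only [Finset.mem_symmDiff]
  by_cases h1 : e ∈ X <;> by_cases h2 : e ∈ Y <;> by_cases h3 : e ∈ Z <;> simp_all

theorem cover3 (M : Finset (Sym2 V)) (hM : LL M) (h : Bless M) :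
    ∃ Z1 Z2 Z3, (Z1 ⊆ M ∧ Ev Z1) ∧ (Z2 ⊆ M ∧ Ev Z2) ∧ (Z3 ⊆ M ∧ Ev Z3) ∧ M ⊆ Z1 ∪ Z2 ∪ Z3 ∧
      3 * (Z1.card + Z2.card + Z3.card) ≤ 5 * M.card := by
  obtain ⟨Z, φ, ⟨hZM, hZ, hφ, hv⟩, hbest⟩ := exists_best M hM h
  obtain ⟨W, W', hW, hW', hWW⟩ := flow_split hM hφ
  have hSM := supp_sub hφ
  -- part (i)
  have hi : Z.card ≤ 3 * (M \ supp φ).card := by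
    obtain ⟨o, oa, ob, oA, oe⟩ := eulerian (hM.mono hZM) hZ
    have os : ∀ x y, o x y ≠ 0 → s(x, y) ∈ Z := by
      intro x y h0
      rw [oA]
      have := abs_lt.1 (ob x y)
      rw [Int.odd_iff]; omega
    have hf : ∀ c : ZMod 3, Flow3 M (fun x y => φ x y + c * (o x y : ZMod 3)) := fun c =>
      hφ.add_int c oa (fun x y h0 => hZM (os x y h0)) oe
    have hcard : ∀ c : ZMod 3, (M \ supp (fun x y => φ x y + c * (o x y : ZMod 3))).card ≤
        (M \ supp φ).card := by
      intro c
      have h1 := hbest Z _ ⟨hZM, hZ, hf c, by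
        intro x y hxy hxyZ
        have : o x y = 0 := by by_contra h0; exact hxyZ (os x y h0)
        rw [this]
        simpa using hv x y hxy hxyZ⟩
      rw [Finset.card_sdiff_of_subset hSM, Finset.card_sdiff_of_subset (supp_sub (hf c))]
      omega
    have hcov : Z ⊆ (M \ supp (fun x y => φ x y + 0 * (o x y : ZMod 3))) ∪
        (M \ supp (fun x y => φ x y + 1 * (o x y : ZMod 3))) ∪
        (M \ supp (fun x y => φ x y + 2 * (o x y : ZMod 3))) := by
      intro e
      induction e using Sym2.ind with
      | _ x y =>
      intro he
      simp only [Finset.mem_union, Finset.mem_sdiff, mem_supp (hf _), hZM he, true_and, not_not]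
      have h1 := (oA x y).1 he
      have h2 := abs_lt.1 (ob x y)
      rw [Int.odd_iff] at h1
      have h3 : o x y = 1 ∨ o x y = -1 := by omega
      have key : ∀ a : ZMod 3, (a + 0 * 1 = 0 ∨ a + 1 * 1 = 0) ∨ a + 2 * 1 = 0 := by decide
      have key2 : ∀ a : ZMod 3, (a + 0 * -1 = 0 ∨ a + 1 * -1 = 0) ∨ a + 2 * -1 = 0 := by decide
      rcases h3 with h3 | h3 <;> rw [h3] <;> push_cast
      · exact key _
      · exact key2 _
    have h1 := Finset.card_le_card hcov
    have h2 := Finset.card_union_le ((M \ supp (fun x y => φ x y + 0 * (o x y : ZMod 3))) ∪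
        (M \ supp (fun x y => φ x y + 1 * (o x y : ZMod 3))))
        (M \ supp (fun x y => φ x y + 2 * (o x y : ZMod 3)))
    have h3 := Finset.card_union_le (M \ supp (fun x y => φ x y + 0 * (o x y : ZMod 3)))
        (M \ supp (fun x y => φ x y + 1 * (o x y : ZMod 3)))
    have := hcard 0
    have := hcard 1
    have := hcard 2
    omega
  -- part (ii)
  have hii : ∀ Y ⊆ supp φ, Ev Y → 2 * ((supp φ ∩ Z) ∩ Y).card ≤ Y.card := by
    intro Y hYS hY
    have h1 := hbest (symmDiff Z Y) φ ⟨by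
        intro e he
        rw [Finset.mem_symmDiff] at he
        rcases he with he | he
        · exact hZM he.1
        · exact hSM (hYS he.1), hZ.symmDiff hY, hφ, by
        intro x y hxy hn
        by_cases hz : s(x, y) ∈ Z
        · rw [Finset.mem_symmDiff] at hn
          have : s(x, y) ∈ Y := by tauto
          exact (mem_supp hφ).1 (hYS this)
        · exact hv x y hxy hz⟩
    have h2 := card_symmDiff_add Z Y
    have h3 : (supp φ ∩ Z) ∩ Y = Z ∩ Y := by
      ext e
      have : e ∈ Y → e ∈ supp φ := fun h => hYS h
      simp only [Finset.mem_inter]; tauto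
    rw [h3]
    omega
  have hWS : W ⊆ supp φ := by rw [← hWW]; exact Finset.subset_union_left
  have hWS' : W' ⊆ supp φ := by rw [← hWW]; exact Finset.subset_union_right
  have hWS'' : symmDiff W W' ⊆ supp φ := by
    intro e he
    rw [Finset.mem_symmDiff] at he
    rcases he with he | he
    · exact hWS he.1
    · exact hWS' he.1
  have i1 := hii W hWS hW
  have i2 := hii W' hWS' hW'
  have i3 := hii _ hWS'' (hW.symmDiff hW')
  have s1 := three_sum (supp φ ∩ Z) W W' (by rw [hWW]; exact Finset.inter_subset_left)
  have s2 := three_sum (supp φ) W W' (by rw [hWW])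
  rw [Finset.inter_eq_right.2 hWS, Finset.inter_eq_right.2 hWS', Finset.inter_eq_right.2 hWS''] at s2
  have c1 := Finset.card_sdiff_add_card_inter M (supp φ)
  rw [Finset.inter_eq_right.2 hSM] at c1
  have c2 := Finset.card_sdiff_add_card_inter Z (supp φ)
  have c3 : Z \ supp φ = M \ supp φ := by
    ext e
    induction e using Sym2.ind with
    | _ x y =>
    simp only [Finset.mem_sdiff, mem_supp hφ]
    constructor
    · rintro ⟨a, b⟩; exact ⟨hZM a, b⟩
    · rintro ⟨a, b⟩
      refine ⟨?_, b⟩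
      by_contra hz; exact b (hv x y a hz)
  rw [c3, Finset.inter_comm] at c2
  have cov : ∀ X Y : Finset (Sym2 V), supp φ ⊆ X ∪ Y → M ⊆ Z ∪ X ∪ Y := by
    intro X Y hXY e
    induction e using Sym2.ind with
    | _ x y =>
    intro he
    by_cases hz : s(x, y) ∈ Z
    · simp [hz]
    · have := hXY ((mem_supp hφ).2 (hv x y he hz))
      simp only [Finset.mem_union] at this ⊢; tauto
  have hWM := hWS.trans hSM
  have hWM' := hWS'.trans hSM
  have hWM'' := hWS''.trans hSM
  by_cases q1 : W.card ≤ (symmDiff W W').card ∧ W'.card ≤ (symmDiff W W').card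
  · exact ⟨Z, W, W', ⟨hZM, hZ⟩, ⟨hWM, hW⟩, ⟨hWM', hW'⟩, cov _ _ (by rw [hWW]), by omega⟩
  by_cases q2 : W.card ≤ W'.card
  · refine ⟨Z, W, _, ⟨hZM, hZ⟩, ⟨hWM, hW⟩, ⟨hWM'', hW.symmDiff hW'⟩, cov _ _ ?_, by omega⟩
    rw [← hWW]
    intro e
    simp only [Finset.mem_union, Finset.mem_symmDiff]; tauto
  · refine ⟨Z, W', _, ⟨hZM, hZ⟩, ⟨hWM', hW'⟩, ⟨hWM'', hW.symmDiff hW'⟩, cov _ _ ?_, by omega⟩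
    rw [← hWW]
    intro e
    simp only [Finset.mem_union, Finset.mem_symmDiff]; tauto

lemma sd_sub {A B M : Finset (Sym2 V)} (hA : A ⊆ M) (hB : B ⊆ M) : symmDiff A B ⊆ M := by
  intro e he
  rw [Finset.mem_symmDiff] at he
  rcases he with he | he
  · exact hA he.1
  · exact hB he.1

/-- minimal representatives use at most half of `M` -/
theorem half (M : Finset (Sym2 V)) (hM : LL M) (h : Bless M) (J : Finset (Sym2 V))
    (hJ : ∀ Y ⊆ M, Ev Y → (J ∩ M).card ≤ (symmDiff J Y ∩ M).card) :
    2 * (J ∩ M).card ≤ M.card := by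
  obtain ⟨X, Y, Z, hX, hY, hZ, hc, -⟩ := cover3 M hM h
  have key : ∀ Y ⊆ M, Ev Y → 2 * ((J ∩ M) ∩ Y).card ≤ (M ∩ Y).card := by
    intro Y hYM hYe
    have h1 := hJ Y hYM hYe
    have h2 := card_symmDiff_add (J ∩ M) Y
    have h3 : symmDiff (J ∩ M) Y = symmDiff J Y ∩ M := by
      ext e
      have : e ∈ Y → e ∈ M := fun h => hYM h
      simp only [Finset.mem_inter, Finset.mem_symmDiff]; tauto
    rw [Finset.inter_eq_right.2 hYM]
    rw [h3] at h2
    omega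
  have s1 := seven_sum (J ∩ M) X Y Z (Finset.inter_subset_right.trans hc)
  have s2 := seven_sum M X Y Z hc
  have k1 := key X hX.1 hX.2
  have k2 := key Y hY.1 hY.2
  have k3 := key Z hZ.1 hZ.2
  have k4 := key _ (sd_sub hX.1 hY.1) (hX.2.symmDiff hY.2)
  have k5 := key _ (sd_sub hX.1 hZ.1) (hX.2.symmDiff hZ.2)
  have k6 := key _ (sd_sub hY.1 hZ.1) (hY.2.symmDiff hZ.2)
  have k7 := key _ (sd_sub (sd_sub hX.1 hY.1) hZ.1) ((hX.2.symmDiff hY.2).symmDiff hZ.2)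
  omega

end covers
end SC

/-! ## Part 5: cycles and decompositions -/
namespace SC
open Relation
open scoped Classical

section cycles
variable [Fintype V]

/-- all edges of `A` are edges of `G` -/
def InG (G : SimpleGraph V) (A : Finset (Sym2 V)) : Prop := ∀ e ∈ A, e ∈ G.edgeSet

lemma InG.mono {G : SimpleGraph V} {A B : Finset (Sym2 V)} (h : InG G B) (hAB : A ⊆ B) : InG G A :=
  fun e he => h e (hAB he)

lemma InG.ll {G : SimpleGraph V} {A : Finset (Sym2 V)} (h : InG G A) : LL A := by
  intro v hv
  have := h _ hv
  rw [SimpleGraph.mem_edgeSet] at this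
  exact G.loopless.irrefl v this

lemma trail_bd {G : SimpleGraph V} {u v : V} (w : G.Walk u v) (hw : w.IsTrail) (x : V) :
    bd w.edges.toFinset x = (if x = u then 1 else 0) + (if x = v then 1 else 0) := by
  induction w with
  | nil =>
    simp only [Walk.edges_nil, List.toFinset_nil, bd_empty]
    split_ifs <;> decide
  | cons h p ih =>
    rename_i a b c
    rw [Walk.isTrail_cons] at hw
    rw [Walk.edges_cons, List.toFinset_cons, Finset.insert_eq, bd_union, bd_single h.ne, ih hw.1]
    · have : ∀ a b c : ZMod 2, a + b + (b + c) = a + c := by decide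
      exact this _ _ _
    · simpa using hw.2

lemma walk_rch {G : SimpleGraph V} {u v : V} (w : G.Walk u v) {x : V} (hx : x ∈ w.support) :
    Rch w.edges.toFinset u x := by
  induction w with
  | nil => simp at hx; subst hx; exact ReflTransGen.refl
  | cons h p ih =>
    rw [Walk.support_cons, List.mem_cons] at hx
    rcases hx with rfl | hx
    · exact ReflTransGen.refl
    · refine (Rch.single ?_).trans ((ih hx).mono ?_)
      · simp
      · intro e he; simp at he ⊢; exact Or.inr he

lemma rch_walk {G : SimpleGraph V} {A : Finset (Sym2 V)} (hA : InG G A) {x y : V}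
    (h : Rch A x y) : ∃ p : G.Walk x y, ∀ e ∈ p.edges, e ∈ A := by
  induction h with
  | refl => exact ⟨Walk.nil, by simp⟩
  | tail _ hbc ih =>
    obtain ⟨p, hp⟩ := ih
    have hadj := hA _ hbc
    rw [SimpleGraph.mem_edgeSet] at hadj
    refine ⟨p.append (Walk.cons hadj Walk.nil), ?_⟩
    intro e he
    rw [Walk.edges_append, List.mem_append] at he
    rcases he with he | he
    · exact hp e he
    · simp at he; rw [he]; exact hbc

/-- finset version of cycles with vertex set -/
def CycS (G : SimpleGraph V) (C : Finset (Sym2 V)) (S : Set V) : Prop :=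
  IsCycleSet G (C : Set (Sym2 V)) S

lemma CycS.data {G : SimpleGraph V} {C : Finset (Sym2 V)} {S : Set V} (h : CycS G C S) :
    InG G C ∧ Ev C ∧ C.Nonempty ∧ (∃ r, r ∈ S) ∧ ∀ u ∈ S, ∀ v ∈ S, Rch C u v := by
  obtain ⟨v, w, hw, hC, hS⟩ := h
  have hCw : C = w.edges.toFinset := by
    ext e
    have : e ∈ (C : Set (Sym2 V)) ↔ e ∈ w.edges := by rw [hC]; rfl
    simpa using this
  refine ⟨?_, ?_, ?_, ?_, ?_⟩
  · intro e he
    rw [hCw, List.mem_toFinset] at he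
    exact w.edges_subset_edgeSet he
  · intro x
    rw [hCw, trail_bd w hw.isTrail]
    have : ∀ a : ZMod 2, a + a = 0 := by decide
    exact this _
  · rw [hCw]
    have h3 := hw.three_le_length
    rw [← Walk.length_edges] at h3
    obtain ⟨e, he⟩ := List.exists_mem_of_length_pos (l := w.edges) (by omega)
    exact ⟨e, by simpa using he⟩
  · exact ⟨v, by rw [hS]; exact w.start_mem_support⟩
  · intro a ha b hb
    rw [hS] at ha hb
    rw [hCw]
    exact (walk_rch w ha).symm.trans (walk_rch w hb)

lemma exists_cycle {G : SimpleGraph V} {H : Finset (Sym2 V)} (hG : InG G H) (hE : Ev H)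
    (hne : H.Nonempty) : ∃ C ⊆ H, ∃ S, CycS G C S := by
  obtain ⟨e, he⟩ := hne
  induction e using Sym2.ind with
  | _ x y =>
  have hadj := hG _ he
  rw [SimpleGraph.mem_edgeSet] at hadj
  have hsub : ({s(x, y)} : Finset (Sym2 V)) ⊆ H := by simpa using he
  have hr : Rch (H \ {s(x, y)}) y x := by
    refine (parity_reach (hG.ll.mono Finset.sdiff_subset) ?_).symm
    intro z
    rw [bd_sdiff hsub, hE, bd_single hadj.ne, zero_add]
  obtain ⟨p, hp⟩ := rch_walk (hG.mono Finset.sdiff_subset) hr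
  have hp' : ∀ e ∈ p.bypass.edges, e ∈ H \ {s(x, y)} := fun e he =>
    hp e (Walk.edges_bypass_subset_edges p he)
  have hc : (Walk.cons hadj p.bypass).IsCycle := by
    rw [Walk.cons_isCycle_iff]
    refine ⟨Walk.bypass_isPath p, ?_⟩
    intro h
    have := hp' _ h
    simp at this
  refine ⟨(Walk.cons hadj p.bypass).edges.toFinset, ?_, _, x, Walk.cons hadj p.bypass, hc, ?_, rfl⟩
  · intro e h
    simp only [List.mem_toFinset, Walk.edges_cons, List.mem_cons] at h
    rcases h with rfl | h
    · exact he
    · exact (Finset.mem_sdiff.1 (hp' _ h)).1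
  · ext e; simp

/-- `𝒞` is a decomposition of `H` into edge-disjoint cycles -/
def Dec (G : SimpleGraph V) (H : Finset (Sym2 V)) (𝒞 : Finset (Finset (Sym2 V))) : Prop :=
  (∀ C ∈ 𝒞, ∃ S, CycS G C S) ∧ (𝒞 : Set (Finset (Sym2 V))).PairwiseDisjoint id ∧ 𝒞.biUnion id = H

lemma Dec.sub {G : SimpleGraph V} {H : Finset (Sym2 V)} {𝒞 : Finset (Finset (Sym2 V))}
    (h : Dec G H 𝒞) {C : Finset (Sym2 V)} (hC : C ∈ 𝒞) : C ⊆ H := by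
  rw [← h.2.2]; exact Finset.subset_biUnion_of_mem id hC

lemma Dec.sum {G : SimpleGraph V} {H : Finset (Sym2 V)} {𝒞 : Finset (Finset (Sym2 V))}
    (h : Dec G H 𝒞) : ∑ C ∈ 𝒞, C.card = H.card := by
  rw [← h.2.2, Finset.card_biUnion h.2.1]; rfl

lemma Dec.nonempty_mem {G : SimpleGraph V} {H : Finset (Sym2 V)} {𝒞 : Finset (Finset (Sym2 V))}
    (h : Dec G H 𝒞) {C : Finset (Sym2 V)} (hC : C ∈ 𝒞) : C.Nonempty := by
  obtain ⟨S, hS⟩ := h.1 C hC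
  exact hS.data.2.2.1

lemma Dec.disj {G : SimpleGraph V} {H₁ H₂ : Finset (Sym2 V)} {𝒞₁ 𝒞₂ : Finset (Finset (Sym2 V))}
    (h₁ : Dec G H₁ 𝒞₁) (h₂ : Dec G H₂ 𝒞₂) (hd : Disjoint H₁ H₂) : Disjoint 𝒞₁ 𝒞₂ := by
  rw [Finset.disjoint_left]
  intro C h1 h2
  obtain ⟨e, he⟩ := h₁.nonempty_mem h1
  exact Finset.disjoint_left.1 hd (h₁.sub h1 he) (h₂.sub h2 he)

lemma Dec.union {G : SimpleGraph V} {H₁ H₂ : Finset (Sym2 V)} {𝒞₁ 𝒞₂ : Finset (Finset (Sym2 V))}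
    (h₁ : Dec G H₁ 𝒞₁) (h₂ : Dec G H₂ 𝒞₂) (hd : Disjoint H₁ H₂) : Dec G (H₁ ∪ H₂) (𝒞₁ ∪ 𝒞₂) := by
  refine ⟨?_, ?_, ?_⟩
  · intro C hC
    rcases Finset.mem_union.1 hC with hC | hC
    · exact h₁.1 C hC
    · exact h₂.1 C hC
  · intro C hC C' hC' hne
    simp only [Finset.coe_union, Set.mem_union, Finset.mem_coe] at hC hC'
    rcases hC with hC | hC <;> rcases hC' with hC' | hC'
    · exact h₁.2.1 hC hC' hne
    · exact Finset.disjoint_of_subset_left (h₁.sub hC)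
        (Finset.disjoint_of_subset_right (h₂.sub hC') hd)
    · exact Finset.disjoint_of_subset_left (h₂.sub hC)
        (Finset.disjoint_of_subset_right (h₁.sub hC') hd.symm)
    · exact h₂.2.1 hC hC' hne
  · rw [Finset.union_biUnion, h₁.2.2, h₂.2.2]

lemma dec_exists {G : SimpleGraph V} (n : ℕ) : ∀ {H : Finset (Sym2 V)}, H.card = n → InG G H →
    Ev H → ∃ 𝒞, Dec G H 𝒞 := by
  induction n using Nat.strong_induction_on with
  | _ n ih =>
  intro H hn hG hE
  by_cases hne : H.Nonempty
  · obtain ⟨C, hCH, S, hS⟩ := exists_cycle hG hE hne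
    obtain ⟨-, hCe, hCn, -, -⟩ := hS.data
    have hlt : (H \ C).card < n := by
      rw [← hn]
      apply Finset.card_lt_card
      obtain ⟨e, he⟩ := hCn
      rw [Finset.ssubset_iff_of_subset Finset.sdiff_subset]
      exact ⟨e, hCH he, by simp [he]⟩
    obtain ⟨𝒞, h𝒞⟩ := ih _ hlt rfl (hG.mono Finset.sdiff_subset)
      (fun v => by rw [bd_sdiff hCH, hE, hCe, add_zero])
    have h1 : Dec G C {C} := ⟨by simp; exact ⟨S, hS⟩, by simp, by simp⟩
    refine ⟨{C} ∪ 𝒞, ?_⟩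
    have := h1.union h𝒞 Finset.disjoint_sdiff
    rwa [Finset.union_sdiff_of_subset hCH] at this
  · rw [Finset.not_nonempty_iff_eq_empty] at hne
    subst hne
    exact ⟨∅, by simp, by simp, by simp⟩

/-- positivity with respect to the set `N` of negative edges -/
def Pos (N C : Finset (Sym2 V)) : Prop := Even (C ∩ N).card

/-- the measure of a decomposition -/
noncomputable def meas (N : Finset (Sym2 V)) (𝒞 : Finset (Finset (Sym2 V))) : ℕ :=
  ∑ C ∈ 𝒞, (1 + if Pos N C then 1 else 0)

lemma card_inter_split {α : Type*} [DecidableEq α] {A C : Finset α} (N : Finset α) (h : A ⊆ C) :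
    (C ∩ N).card = (A ∩ N).card + ((C \ A) ∩ N).card := by
  rw [← Finset.card_union_of_disjoint]
  · congr 1
    rw [← Finset.union_inter_distrib_right, Finset.union_sdiff_of_subset h]
  · exact Finset.disjoint_of_subset_left Finset.inter_subset_left
      (Finset.disjoint_of_subset_right Finset.inter_subset_left Finset.disjoint_sdiff)

lemma meas_two {G : SimpleGraph V} {N Y : Finset (Sym2 V)} {𝒞 : Finset (Finset (Sym2 V))}
    (h : Dec G Y 𝒞) (hY : Y.Nonempty) (hp : Pos N Y) : 2 ≤ meas N 𝒞 := by
  have hne : 𝒞.Nonempty := by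
    by_contra hcon
    rw [Finset.not_nonempty_iff_eq_empty] at hcon
    have := h.2.2
    rw [hcon] at this
    simp at this
    rw [← this] at hY
    simp at hY
  by_cases h1 : 𝒞.card = 1
  · obtain ⟨C, hC⟩ := Finset.card_eq_one.1 h1
    have hCY := h.2.2
    rw [hC] at hCY
    simp at hCY
    rw [hC, meas, Finset.sum_singleton, hCY, if_pos hp]
  · have : 𝒞.card ≤ meas N 𝒞 := by
      unfold meas
      rw [Finset.card_eq_sum_ones]
      exact Finset.sum_le_sum fun C _ => by omega
    have := hne.card_pos
    omega

lemma max_dec {G : SimpleGraph V} {N H : Finset (Sym2 V)} {𝒞 : Finset (Finset (Sym2 V))}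
    (h : Dec G H 𝒞) (hmax : ∀ 𝒞', Dec G H 𝒞' → meas N 𝒞' ≤ meas N 𝒞)
    {C₁ C₂ : Finset (Sym2 V)} (h₁ : C₁ ∈ 𝒞) (h₂ : C₂ ∈ 𝒞) (hne : C₁ ≠ C₂)
    (n₁ : ¬ Pos N C₁) (n₂ : ¬ Pos N C₂) {S₁ S₂ : Set V} (hS₁ : CycS G C₁ S₁) (hS₂ : CycS G C₂ S₂)
    {u v : V} (hu₁ : u ∈ S₁) (hu₂ : u ∈ S₂) (hv₁ : v ∈ S₁) (hv₂ : v ∈ S₂) : u = v := by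
  by_contra huv
  obtain ⟨g₁, e₁, -, -, c₁⟩ := hS₁.data
  obtain ⟨g₂, e₂, -, -, c₂⟩ := hS₂.data
  have hd : Disjoint C₁ C₂ := h.2.1 h₁ h₂ hne
  obtain ⟨A₁, hA₁, b₁⟩ := pathset g₁.ll (c₁ u hu₁ v hv₁)
  obtain ⟨A₂, hA₂, b₂⟩ := pathset g₂.ll (c₂ u hu₂ v hv₂)
  have nonem : ∀ A : Finset (Sym2 V),
      (∀ x, bd A x = (if x = u then 1 else 0) + (if x = v then 1 else 0)) → A.Nonempty := by
    intro A hA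
    by_contra hcon
    rw [Finset.not_nonempty_iff_eq_empty] at hcon
    have := hA u
    rw [hcon, bd_empty] at this
    simp [huv] at this
  have comp : ∀ {A C : Finset (Sym2 V)}, A ⊆ C → Ev C →
      (∀ x, bd A x = (if x = u then 1 else 0) + (if x = v then 1 else 0)) →
      (∀ x, bd (C \ A) x = (if x = u then 1 else 0) + (if x = v then 1 else 0)) := by
    intro A C hA hC hb x
    rw [bd_sdiff hA, hC, hb, zero_add]
  obtain ⟨A₁, hA₁, b₁, hpar⟩ : ∃ A ⊆ C₁,
      (∀ x, bd A x = (if x = u then 1 else 0) + (if x = v then 1 else 0)) ∧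
      Even ((A ∩ N).card + (A₂ ∩ N).card) := by
    by_cases hp : Even ((A₁ ∩ N).card + (A₂ ∩ N).card)
    · exact ⟨A₁, hA₁, b₁, hp⟩
    · refine ⟨C₁ \ A₁, Finset.sdiff_subset, comp hA₁ e₁ b₁, ?_⟩
      have := card_inter_split N hA₁
      unfold Pos at n₁
      rw [Nat.not_even_iff] at *
      rw [Nat.even_iff]
      omega
  have s₁ := card_inter_split N hA₁
  have s₂ := card_inter_split N hA₂
  have hdA : Disjoint A₁ A₂ := Finset.disjoint_of_subset_left hA₁
    (Finset.disjoint_of_subset_right hA₂ hd)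
  have hdB : Disjoint (C₁ \ A₁) (C₂ \ A₂) := Finset.disjoint_of_subset_left Finset.sdiff_subset
    (Finset.disjoint_of_subset_right Finset.sdiff_subset hd)
  have hdd : Disjoint (A₁ ∪ A₂) ((C₁ \ A₁) ∪ (C₂ \ A₂)) := by
    rw [Finset.disjoint_left] at *
    intro e he he'
    simp only [Finset.mem_union, Finset.mem_sdiff] at he he'
    rcases he with he | he
    · rcases he' with he' | he'
      · exact he'.2 he
      · exact hd (hA₁ he) he'.1
    · rcases he' with he' | he'
      · exact hd he'.1 (hA₂ he)
      · exact he'.2 he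
  have two : ∀ a : ZMod 2, a + a = 0 := by decide
  have hYE : Ev (A₁ ∪ A₂) := fun x => by rw [bd_union hdA, b₁, b₂]; exact two _
  have hYE' : Ev ((C₁ \ A₁) ∪ (C₂ \ A₂)) := fun x => by
    rw [bd_union hdB, comp hA₁ e₁ b₁, comp hA₂ e₂ b₂]; exact two _
  have pcard : ∀ {A B : Finset (Sym2 V)}, Disjoint A B →
      ((A ∪ B) ∩ N).card = (A ∩ N).card + (B ∩ N).card := by
    intro A B hAB
    rw [Finset.union_inter_distrib_right, Finset.card_union_of_disjoint]
    exact Finset.disjoint_of_subset_left Finset.inter_subset_left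
      (Finset.disjoint_of_subset_right Finset.inter_subset_left hAB)
  have hYP : Pos N (A₁ ∪ A₂) := by unfold Pos; rw [pcard hdA]; exact hpar
  have hYP' : Pos N ((C₁ \ A₁) ∪ (C₂ \ A₂)) := by
    unfold Pos at *; rw [pcard hdB]
    rw [Nat.not_even_iff] at *
    rw [Nat.even_iff] at *
    omega
  have hYG : InG G (A₁ ∪ A₂) := fun e he => by
    rcases Finset.mem_union.1 he with he | he
    · exact g₁ e (hA₁ he)
    · exact g₂ e (hA₂ he)
  have hYG' : InG G ((C₁ \ A₁) ∪ (C₂ \ A₂)) := fun e he => by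
    rcases Finset.mem_union.1 he with he | he
    · exact g₁ e (Finset.sdiff_subset he)
    · exact g₂ e (Finset.sdiff_subset he)
  obtain ⟨𝒜, h𝒜⟩ := dec_exists _ rfl hYG hYE
  obtain ⟨ℬ, hℬ⟩ := dec_exists _ rfl hYG' hYE'
  have m1 := meas_two h𝒜 ((nonem A₁ b₁).mono Finset.subset_union_left) hYP
  have m2 := meas_two hℬ ((nonem _ (comp hA₁ e₁ b₁)).mono Finset.subset_union_left) hYP'
  have hAB := h𝒜.union hℬ hdd
  have hUU : (A₁ ∪ A₂) ∪ ((C₁ \ A₁) ∪ (C₂ \ A₂)) = C₁ ∪ C₂ := by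
    ext e
    have q1 : e ∈ A₁ → e ∈ C₁ := fun h => hA₁ h
    have q2 : e ∈ A₂ → e ∈ C₂ := fun h => hA₂ h
    simp only [Finset.mem_union, Finset.mem_sdiff]; tauto
  rw [hUU] at hAB
  have hrest : Dec G (H \ (C₁ ∪ C₂)) (𝒞 \ {C₁, C₂}) := by
    refine ⟨fun C hC => h.1 C (Finset.sdiff_subset hC), ?_, ?_⟩
    · exact h.2.1.subset (by exact_mod_cast Finset.sdiff_subset)
    · ext e
      simp only [Finset.mem_biUnion, Finset.mem_sdiff, Finset.mem_insert, Finset.mem_singleton,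
        Finset.mem_union, id, not_or]
      constructor
      · rintro ⟨C, ⟨hC, hC1, hC2⟩, he⟩
        refine ⟨h.sub hC he, ?_, ?_⟩
        · intro he1; exact Finset.disjoint_left.1 (h.2.1 hC h₁ hC1) he he1
        · intro he1; exact Finset.disjoint_left.1 (h.2.1 hC h₂ hC2) he he1
      · rintro ⟨he, k1, k2⟩
        rw [← h.2.2, Finset.mem_biUnion] at he
        obtain ⟨C, hC, heC⟩ := he
        exact ⟨C, ⟨hC, by rintro rfl; exact k1 heC, by rintro rfl; exact k2 heC⟩, heC⟩
  have hCC : C₁ ∪ C₂ ⊆ H := Finset.union_subset (h.sub h₁) (h.sub h₂)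
  have hnew := hrest.union hAB Finset.sdiff_disjoint
  rw [Finset.sdiff_union_of_subset hCC] at hnew
  have hle := hmax _ hnew
  have e1 : meas N ((𝒞 \ {C₁, C₂}) ∪ (𝒜 ∪ ℬ)) = meas N (𝒞 \ {C₁, C₂}) + (meas N 𝒜 + meas N ℬ) := by
    unfold meas
    rw [Finset.sum_union (hrest.disj hAB Finset.sdiff_disjoint), Finset.sum_union (h𝒜.disj hℬ hdd)]
  have e2 : meas N 𝒞 = meas N (𝒞 \ {C₁, C₂}) + 2 := by
    unfold meas
    rw [← Finset.sum_sdiff (s₁ := {C₁, C₂}) (s₂ := 𝒞)]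
    · rw [Finset.sum_pair hne, if_neg n₁, if_neg n₂]
    · intro C hC
      simp at hC
      rcases hC with rfl | rfl
      · exact h₁
      · exact h₂
  omega

lemma exists_max_dec {G : SimpleGraph V} (N : Finset (Sym2 V)) {H : Finset (Sym2 V)}
    (hG : InG G H) (hE : Ev H) :
    ∃ 𝒞, Dec G H 𝒞 ∧ ∀ 𝒞', Dec G H 𝒞' → meas N 𝒞' ≤ meas N 𝒞 := by
  obtain ⟨𝒞₀, h₀⟩ := dec_exists _ rfl hG hE
  obtain ⟨𝒞, h, hm⟩ := Finset.exists_max_image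
    ((Finset.univ : Finset (Finset (Finset (Sym2 V)))).filter (Dec G H)) (meas N)
    ⟨𝒞₀, by simpa using h₀⟩
  simp only [Finset.mem_filter, Finset.mem_univ, true_and] at h hm
  exact ⟨𝒞, h, hm⟩

end cycles
end SC

/-! ## Part 6: barbells and T-joins -/
namespace SC
open Relation
open scoped Classical

section barbells
variable [Fintype V]

lemma neg_iff {G : SimpleGraph V} {σ : Sym2 V → Bool} {N C : Finset (Sym2 V)}
    (hN : ∀ e, e ∈ N ↔ e ∈ G.edgeSet ∧ σ e = true) (hC : InG G C) :
    {e ∈ (C : Set (Sym2 V)) | σ e = true}.ncard = (C ∩ N).card := by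
  rw [← Set.ncard_coe_finset]
  congr 1
  ext e
  have : e ∈ C → e ∈ G.edgeSet := hC e
  simp only [Set.mem_setOf_eq, Finset.mem_coe, Finset.mem_inter, hN]
  tauto

lemma walk_min {G : SimpleGraph V} {A : Finset (Sym2 V)} {S₁ S₂ : Set V}
    (h : ∃ u v, ∃ p : G.Walk u v, u ∈ S₁ ∧ v ∈ S₂ ∧ ∀ e ∈ p.edges, e ∈ A) :
    ∃ u v, ∃ p : G.Walk u v, u ∈ S₁ ∧ v ∈ S₂ ∧ (∀ e ∈ p.edges, e ∈ A) ∧ p.IsPath ∧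
      {x | x ∈ p.support} ∩ S₁ = {u} ∧ {x | x ∈ p.support} ∩ S₂ = {v} := by
  have hex : ∃ n, ∃ u v, ∃ p : G.Walk u v, (u ∈ S₁ ∧ v ∈ S₂ ∧ ∀ e ∈ p.edges, e ∈ A) ∧
      p.length = n := by
    obtain ⟨u, v, p, hp⟩ := h
    exact ⟨_, u, v, p, hp, rfl⟩
  obtain ⟨u, v, p, ⟨hu, hv, hpA⟩, hl⟩ := Nat.find_spec hex
  have hmin : ∀ u' v' (q : G.Walk u' v'), u' ∈ S₁ → v' ∈ S₂ → (∀ e ∈ q.edges, e ∈ A) →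
      p.length ≤ q.length := by
    intro u' v' q h1 h2 h3
    rw [hl]
    exact Nat.find_min' hex ⟨u', v', q, ⟨h1, h2, h3⟩, rfl⟩
  have hb := Walk.length_bypass_le_length p
  have hbA : ∀ e ∈ p.bypass.edges, e ∈ A := fun e he => hpA e (Walk.edges_bypass_subset_edges p he)
  refine ⟨u, v, p.bypass, hu, hv, hbA, Walk.bypass_isPath p, ?_, ?_⟩
  · ext x
    simp only [Set.mem_inter_iff, Set.mem_setOf_eq, Set.mem_singleton_iff]
    constructor
    · rintro ⟨hx, hxS⟩
      have h1 := hmin x v (p.bypass.dropUntil x hx) hxS hv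
        (fun e he => hbA e (Walk.edges_dropUntil_subset_edges _ hx he))
      have h2 := congrArg Walk.length (Walk.take_spec p.bypass hx)
      rw [Walk.length_append] at h2
      have h3 : (p.bypass.takeUntil x hx).length = 0 := by omega
      exact (Walk.eq_of_length_eq_zero h3).symm
    · rintro rfl
      exact ⟨Walk.start_mem_support _, hu⟩
  · ext x
    simp only [Set.mem_inter_iff, Set.mem_setOf_eq, Set.mem_singleton_iff]
    constructor
    · rintro ⟨hx, hxS⟩
      have h1 := hmin u x (p.bypass.takeUntil x hx) hu hxS
        (fun e he => hbA e (Walk.edges_takeUntil_subset_edges _ hx he))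
      have h2 := congrArg Walk.length (Walk.take_spec p.bypass hx)
      rw [Walk.length_append] at h2
      have h3 : (p.bypass.dropUntil x hx).length = 0 := by omega
      exact Walk.eq_of_length_eq_zero h3
    · rintro rfl
      exact ⟨Walk.end_mem_support _, hv⟩

lemma barbell {G : SimpleGraph V} {σ : Sym2 V → Bool} {C₁ C₂ A : Finset (Sym2 V)} {S₁ S₂ : Set V}
    (h₁ : IsNegCycle G σ (C₁ : Set (Sym2 V)) S₁) (h₂ : IsNegCycle G σ (C₂ : Set (Sym2 V)) S₂)
    (hone : ∀ u v, u ∈ S₁ → u ∈ S₂ → v ∈ S₁ → v ∈ S₂ → u = v)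
    (hA : InG G A) {r₁ r₂ : V} (hr₁ : r₁ ∈ S₁) (hr₂ : r₂ ∈ S₂) (hr : Rch A r₁ r₂) :
    ∃ B : Finset (Sym2 V), IsBarbell G σ (B : Set (Sym2 V)) ∧ C₁ ∪ C₂ ⊆ B ∧ B ⊆ C₁ ∪ C₂ ∪ A := by
  by_cases hmeet : ∃ v, v ∈ S₁ ∧ v ∈ S₂
  · obtain ⟨v, hv₁, hv₂⟩ := hmeet
    refine ⟨C₁ ∪ C₂, ⟨C₁, C₂, Or.inl ⟨S₁, S₂, h₁, h₂, ⟨v, ?_⟩, by simp⟩⟩, subset_rfl,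
      Finset.subset_union_left⟩
    ext x
    simp only [Set.mem_inter_iff, Set.mem_singleton_iff]
    constructor
    · rintro ⟨a, b⟩; exact hone x v a b hv₁ hv₂
    · rintro rfl; exact ⟨hv₁, hv₂⟩
  · obtain ⟨p, hp⟩ := rch_walk hA hr
    obtain ⟨u, v, p, hu, hv, hpA, hpath, i₁, i₂⟩ := walk_min ⟨r₁, r₂, p, hr₁, hr₂, hp⟩
    refine ⟨C₁ ∪ C₂ ∪ p.edges.toFinset, ⟨C₁, C₂, Or.inr ⟨S₁, S₂, u, v, p, h₁, h₂, ?_, hpath, hu, hv,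
      i₁, i₂, ?_⟩⟩, Finset.subset_union_left, ?_⟩
    · rw [Set.disjoint_left]; intro x a b; exact hmeet ⟨x, a, b⟩
    · ext e; simp [or_assoc]
    · apply Finset.union_subset_union subset_rfl
      intro e he
      exact hpA e (by simpa using he)

lemma pairing {G : SimpleGraph V} {σ : Sym2 V → Bool} (S : Finset (Sym2 V) → Set V)
    (r : Finset (Sym2 V) → V) (n : ℕ) :
    ∀ (𝒩 : Finset (Finset (Sym2 V))) (Q : Finset (Sym2 V)), 𝒩.card = n → InG G Q →
    (∀ C ∈ 𝒩, IsNegCycle G σ (C : Set (Sym2 V)) (S C) ∧ r C ∈ S C) →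
    (∀ C₁ ∈ 𝒩, ∀ C₂ ∈ 𝒩, C₁ ≠ C₂ → ∀ u v, u ∈ S C₁ → u ∈ S C₂ → v ∈ S C₁ → v ∈ S C₂ → u = v) →
    (∀ v, bd Q v = ∑ C ∈ 𝒩, if v = r C then 1 else 0) →
    ∃ 𝓑 : Multiset (Finset (Sym2 V)), (∀ B ∈ 𝓑, IsBarbell G σ (B : Set (Sym2 V))) ∧
      (∀ C ∈ 𝒩, ∃ B ∈ 𝓑, C ⊆ B) ∧
      (𝓑.map Finset.card).sum ≤ ∑ C ∈ 𝒩, C.card + Q.card := by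
  induction n using Nat.strong_induction_on with
  | _ n ih =>
  intro 𝒩 Q hn hQ hneg hone hbd
  by_cases hne : 𝒩.Nonempty
  · obtain ⟨C₁, h₁⟩ := hne
    have hex : ∃ C₂ ∈ 𝒩, C₂ ≠ C₁ ∧ Rch Q (r C₁) (r C₂) := by
      by_contra hcon
      push Not at hcon
      have hc := bd_cut hQ.ll (Finset.univ.filter (fun x => Rch Q (r C₁) x))
      have h0 : ∑ v ∈ Finset.univ.filter (fun x => Rch Q (r C₁) x),
          ∑ w ∈ (Finset.univ.filter (fun x => Rch Q (r C₁) x))ᶜ,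
            (if s(v, w) ∈ Q then (1 : ZMod 2) else 0) = 0 := by
        refine Finset.sum_eq_zero fun x hx => Finset.sum_eq_zero fun y hy => ?_
        rw [if_neg]
        intro hxy
        simp at hx hy
        exact hy (hx.trans (Rch.single hxy))
      rw [h0] at hc
      simp only [hbd] at hc
      rw [Finset.sum_comm, Finset.sum_eq_single C₁] at hc
      · simp [Rch.refl] at hc
      · intro C hC hCne
        simp [hcon C hC hCne]
      · intro h; exact absurd h₁ h
    obtain ⟨C₂, h₂, hne, hr⟩ := hex
    obtain ⟨A, hAQ, hAb⟩ := pathset hQ.ll hr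
    have hrA := parity_reach (hQ.ll.mono hAQ) hAb
    obtain ⟨B, hB, hB1, hB2⟩ := barbell (hneg C₁ h₁).1 (hneg C₂ h₂).1
      (hone C₁ h₁ C₂ h₂ hne.symm) (hQ.mono hAQ) (hneg C₁ h₁).2 (hneg C₂ h₂).2 hrA
    have hpair : ({C₁, C₂} : Finset (Finset (Sym2 V))) ⊆ 𝒩 := by
      intro C hC
      simp at hC
      rcases hC with rfl | rfl
      · exact h₁
      · exact h₂
    have hlt : (𝒩 \ {C₁, C₂}).card < n := by
      rw [← hn]
      apply Finset.card_lt_card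
      rw [Finset.ssubset_iff_of_subset Finset.sdiff_subset]
      exact ⟨C₁, h₁, by simp⟩
    have hsum : ∀ v, ∑ C ∈ 𝒩, (if v = r C then (1 : ZMod 2) else 0) =
        ∑ C ∈ 𝒩 \ {C₁, C₂}, (if v = r C then (1 : ZMod 2) else 0) +
          ((if v = r C₁ then 1 else 0) + (if v = r C₂ then 1 else 0)) := by
      intro v
      rw [← Finset.sum_sdiff hpair, Finset.sum_pair hne.symm]
    obtain ⟨𝓑, hb1, hb2, hb3⟩ := ih _ hlt (𝒩 \ {C₁, C₂}) (Q \ A) rfl (hQ.mono Finset.sdiff_subset)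
      (fun C hC => hneg C (Finset.sdiff_subset hC))
      (fun C hC C' hC' => hone C (Finset.sdiff_subset hC) C' (Finset.sdiff_subset hC'))
      (by
        intro v
        rw [bd_sdiff hAQ, hAb, hbd, hsum, add_assoc]
        have : ∀ a : ZMod 2, a + a = 0 := by decide
        rw [this, add_zero])
    refine ⟨B ::ₘ 𝓑, ?_, ?_, ?_⟩
    · intro B' hB'
      rcases Multiset.mem_cons.1 hB' with rfl | hB'
      · exact hB
      · exact hb1 B' hB'
    · intro C hC
      by_cases hC1 : C ∈ ({C₁, C₂} : Finset (Finset (Sym2 V)))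
      · refine ⟨B, by simp, ?_⟩
        simp at hC1
        rcases hC1 with rfl | rfl
        · exact Finset.subset_union_left.trans hB1
        · exact Finset.subset_union_right.trans hB1
      · obtain ⟨B', hB', hCB⟩ := hb2 C (Finset.mem_sdiff.2 ⟨hC, hC1⟩)
        exact ⟨B', by simp [hB'], hCB⟩
    · rw [Multiset.map_cons, Multiset.sum_cons, ← Finset.sum_sdiff hpair, Finset.sum_pair hne.symm]
      have k1 := Finset.card_le_card hB2
      have k2 := Finset.card_union_le (C₁ ∪ C₂) A
      have k3 := Finset.card_union_le C₁ C₂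
      have k4 := Finset.card_sdiff_add_card_eq_card hAQ
      omega
  · rw [Finset.not_nonempty_iff_eq_empty] at hne
    subst hne
    exact ⟨0, by simp, by simp, by simp⟩

lemma tjoin {P : Finset (Sym2 V)} (hP : LL P) (hc : ∀ x y, Rch P x y) (t : V → ZMod 2)
    (ht : ∑ v, t v = 0) : ∃ Q ⊆ P, ∀ v, bd Q v = t v := by
  by_cases hV : Nonempty V
  · obtain ⟨z⟩ := hV
    have key : ∀ T : Finset V, ∃ Q ⊆ P, ∀ x, bd Q x =
        ∑ v ∈ T, ((if x = v then 1 else 0) + (if x = z then 1 else 0)) := by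
      intro T
      induction T using Finset.induction_on with
      | empty => exact ⟨∅, by simp, fun x => by simp [bd_empty]⟩
      | insert a T ha ih =>
        obtain ⟨Q, hQ, hb⟩ := ih
        obtain ⟨A, hA, hAb⟩ := pathset hP (hc a z)
        refine ⟨symmDiff A Q, sd_sub hA hQ, fun x => ?_⟩
        rw [bd_symmDiff, hAb, hb, Finset.sum_insert ha]
    obtain ⟨Q, hQ, hb⟩ := key (Finset.univ.filter (fun v => t v = 1))
    refine ⟨Q, hQ, fun x => ?_⟩
    have h01 : ∀ a : ZMod 2, a = if a = 1 then 1 else 0 := by decide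
    have h1 : ∑ v ∈ Finset.univ.filter (fun v => t v = 1), (if x = z then (1 : ZMod 2) else 0) = 0 := by
      rw [Finset.sum_filter]
      split_ifs with hxz
      · refine Eq.trans ?_ ht
        exact Finset.sum_congr rfl fun v _ => (h01 _).symm
      · simp
    rw [hb, Finset.sum_add_distrib, h1, add_zero, Finset.sum_ite_eq]
    simp only [Finset.mem_filter, Finset.mem_univ, true_and]
    exact (h01 _).symm
  · exact ⟨∅, by simp, fun v => absurd ⟨v⟩ hV⟩

lemma tjoin_min {P M : Finset (Sym2 V)} (hP : LL P) (hc : ∀ x y, Rch P x y) (hMP : M ⊆ P)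
    (hM : Bless M) (t : V → ZMod 2) (ht : ∑ v, t v = 0) :
    ∃ Q ⊆ P, (∀ v, bd Q v = t v) ∧ 2 * (Q ∩ M).card ≤ M.card := by
  obtain ⟨Q₀, hQ₀, hb₀⟩ := tjoin hP hc t ht
  obtain ⟨Q, h, hm⟩ := Finset.exists_min_image
    ((Finset.univ : Finset (Finset (Sym2 V))).filter (fun Q => Q ⊆ P ∧ ∀ v, bd Q v = t v))
    (fun Q => (Q ∩ M).card) ⟨Q₀, by simpa using ⟨hQ₀, hb₀⟩⟩
  simp only [Finset.mem_filter, Finset.mem_univ, true_and] at h hm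
  refine ⟨Q, h.1, h.2, half M (hP.mono hMP) hM Q ?_⟩
  intro Y hYM hY
  apply hm
  refine ⟨sd_sub h.1 (hYM.trans hMP), fun v => ?_⟩
  rw [bd_symmDiff, hY, add_zero, h.2]

end barbells
end SC

/-! ## Part 7: the covering argument -/
namespace SC
open Relation
open scoped Classical

section covering
variable [Fintype V]

/-- covering an even subset of the positive edges by positive cycles -/
lemma pos_cover {G : SimpleGraph V} {σ : Sym2 V → Bool} {N P Z : Finset (Sym2 V)}
    (hN : ∀ e, e ∈ N ↔ e ∈ G.edgeSet ∧ σ e = true)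
    (hP : ∀ e, e ∈ P ↔ e ∈ G.edgeSet ∧ σ e ≠ true) (hZ : Z ⊆ P) (hE : Ev Z) :
    ∃ 𝓕 : Multiset (Finset (Sym2 V)), (∀ C ∈ 𝓕, IsSignedCircuit G σ (C : Set (Sym2 V))) ∧
      (∀ e ∈ Z, ∃ C ∈ 𝓕, e ∈ C) ∧ (𝓕.map Finset.card).sum = Z.card := by
  have hG : InG G Z := fun e he => ((hP e).1 (hZ he)).1
  obtain ⟨𝒞, h𝒞⟩ := dec_exists _ rfl hG hE
  refine ⟨𝒞.val, ?_, ?_, h𝒞.sum⟩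
  · intro C hC
    refine Or.inl ⟨h𝒞.1 C hC, ?_⟩
    rw [neg_iff hN (hG.mono (h𝒞.sub hC))]
    have : C ∩ N = ∅ := by
      ext e
      simp only [Finset.mem_inter, Finset.notMem_empty, iff_false, not_and]
      intro he hn
      exact ((hP e).1 (hZ (h𝒞.sub hC he))).2 ((hN e).1 hn).2
    simp [this]
  · intro e he
    rw [← h𝒞.2.2, Finset.mem_biUnion] at he
    exact he

lemma core {G : SimpleGraph V} {σ : Sym2 V → Bool} {N P M : Finset (Sym2 V)}
    (hN : ∀ e, e ∈ N ↔ e ∈ G.edgeSet ∧ σ e = true)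
    (hP : ∀ e, e ∈ P ↔ e ∈ G.edgeSet ∧ σ e ≠ true) (hNe : Even N.card)
    (hc : ∀ x y, Rch P x y) (hMP : M ⊆ P) (hM : Bless M)
    (hB : ∀ J ⊆ P, Ev (N ∪ J) → P \ M ⊆ J) (hpos : 0 < N.card + P.card) :
    ∃ 𝓕 : Multiset (Finset (Sym2 V)), (∀ C ∈ 𝓕, IsSignedCircuit G σ (C : Set (Sym2 V))) ∧
      (∀ e, e ∈ G.edgeSet → ∃ C ∈ 𝓕, e ∈ C) ∧
      3 * (𝓕.map Finset.card).sum < 8 * (N.card + P.card) := by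
  have hPG : InG G P := fun e he => ((hP e).1 he).1
  have hNG : InG G N := fun e he => ((hN e).1 he).1
  have hPL := hPG.ll
  have hdisj : Disjoint N P := by
    rw [Finset.disjoint_left]; intro e a b; exact ((hP e).1 b).2 ((hN e).1 a).2
  obtain ⟨Z1, Z2, Z3, ⟨z1, e1⟩, ⟨z2, e2⟩, ⟨z3, e3⟩, hcov, hlen⟩ := cover3 M (hPL.mono hMP) hM
  obtain ⟨F1, f1, g1, l1⟩ := pos_cover hN hP (z1.trans hMP) e1
  obtain ⟨F2, f2, g2, l2⟩ := pos_cover hN hP (z2.trans hMP) e2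
  obtain ⟨F3, f3, g3, l3⟩ := pos_cover hN hP (z3.trans hMP) e3
  have hmc : (P \ M).card + M.card = P.card := Finset.card_sdiff_add_card_eq_card hMP
  have hcovM : ∀ e ∈ M, ∃ C ∈ F1 + F2 + F3, e ∈ C := by
    intro e he
    have := hcov he
    simp only [Finset.mem_union] at this
    rcases this with (h | h) | h
    · obtain ⟨C, a, b⟩ := g1 e h; exact ⟨C, by simp [a], b⟩
    · obtain ⟨C, a, b⟩ := g2 e h; exact ⟨C, by simp [a], b⟩
    · obtain ⟨C, a, b⟩ := g3 e h; exact ⟨C, by simp [a], b⟩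
  have hcirc : ∀ C ∈ F1 + F2 + F3, IsSignedCircuit G σ (C : Set (Sym2 V)) := by
    intro C hC
    simp only [Multiset.mem_add] at hC
    rcases hC with (h | h) | h
    · exact f1 C h
    · exact f2 C h
    · exact f3 C h
  have hl : ((F1 + F2 + F3).map Finset.card).sum = Z1.card + Z2.card + Z3.card := by
    simp [l1, l2, l3]
  by_cases hN0 : N = ∅
  · have hPM : P \ M ⊆ ∅ := hB ∅ (by simp) (by intro v; simp [hN0, bd_empty])
    have hc0 : (P \ M).card = 0 := by rw [Finset.subset_empty.1 hPM]; rfl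
    refine ⟨F1 + F2 + F3, hcirc, ?_, ?_⟩
    · intro e he
      apply hcovM
      have heP : e ∈ P := by
        rw [hP]; refine ⟨he, fun h => ?_⟩
        have := (hN e).2 ⟨he, h⟩
        simp [hN0] at this
      by_contra hcon
      exact absurd (hPM (Finset.mem_sdiff.2 ⟨heP, hcon⟩)) (by simp)
    · rw [hl]; omega
  have hNpos : 0 < N.card := Finset.card_pos.2 (Finset.nonempty_iff_ne_empty.2 hN0)
  obtain ⟨J, hJP, hJ, hJM⟩ := tjoin_min hPL hc hMP hM (bd N) (by
    rw [bd_cut hNG.ll]; simp)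
  have hdJ : Disjoint N J := Finset.disjoint_of_subset_right hJP hdisj
  have hEv : Ev (N ∪ J) := by
    intro v
    rw [bd_union hdJ, hJ]
    have : ∀ a : ZMod 2, a + a = 0 := by decide
    exact this _
  have hHG : InG G (N ∪ J) := by
    intro e he
    rcases Finset.mem_union.1 he with h | h
    · exact hNG e h
    · exact hPG e (hJP h)
  have hBJ := hB J hJP hEv
  obtain ⟨𝒞, h𝒞, hmax⟩ := exists_max_dec N hHG hEv
  set 𝒩 := 𝒞.filter (fun C => ¬ Pos N C) with h𝒩
  set 𝒟 := 𝒞.filter (fun C => Pos N C) with h𝒟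
  have hS : ∀ C, ∃ S, C ∈ 𝒞 → CycS G C S := by
    intro C
    by_cases h : C ∈ 𝒞
    · obtain ⟨S, hS⟩ := h𝒞.1 C h; exact ⟨S, fun _ => hS⟩
    · exact ⟨∅, fun h' => absurd h' h⟩
  choose S hS using hS
  have hV : Nonempty V := by
    obtain ⟨e, he⟩ := Finset.nonempty_iff_ne_empty.2 hN0
    induction e using Sym2.ind with
    | _ x y => exact ⟨x⟩
  have hr : ∀ C, ∃ r, C ∈ 𝒞 → r ∈ S C := by
    intro C
    by_cases h : C ∈ 𝒞
    · obtain ⟨r, hr⟩ := (hS C h).data.2.2.2.1; exact ⟨r, fun _ => hr⟩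
    · exact ⟨Classical.arbitrary V, fun h' => absurd h' h⟩
  choose r hr using hr
  -- the number of negative cycles is even
  have hsum : ∑ C ∈ 𝒞, (C ∩ N).card = N.card := by
    rw [← Finset.card_biUnion]
    · congr 1
      ext e
      simp only [Finset.mem_biUnion, Finset.mem_inter]
      constructor
      · rintro ⟨C, -, -, h⟩; exact h
      · intro h
        have h' : e ∈ 𝒞.biUnion id := by rw [h𝒞.2.2]; exact Finset.mem_union_left _ h
        obtain ⟨C, hC, he⟩ := Finset.mem_biUnion.1 h'
        exact ⟨C, hC, he, h⟩
    · intro C hC C' hC' hne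
      exact Finset.disjoint_of_subset_left Finset.inter_subset_left
        (Finset.disjoint_of_subset_right Finset.inter_subset_left (h𝒞.2.1 hC hC' hne))
  have hev𝒩 : ((𝒩.card : ℕ) : ZMod 2) = 0 := by
    have h1 : ((∑ C ∈ 𝒞, (C ∩ N).card : ℕ) : ZMod 2) = 0 := by
      rw [hsum]; exact (ZMod.natCast_eq_zero_iff_even).2 hNe
    rw [← h1, h𝒩, Finset.card_filter]
    push_cast
    refine Finset.sum_congr rfl fun C _ => ?_
    by_cases h : Pos N C
    · simp only [h, not_true, if_false]
      exact ((ZMod.natCast_eq_zero_iff_even).2 h).symm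
    · simp only [h, not_false_iff, if_true]
      exact ((ZMod.natCast_eq_one_iff_odd).2 (Nat.not_even_iff_odd.1 h)).symm
  obtain ⟨Q, hQP, hQ, hQM⟩ := tjoin_min hPL hc hMP hM (fun v => ∑ C ∈ 𝒩, if v = r C then 1 else 0)
    (by rw [Finset.sum_comm]; simp [hev𝒩])
  have hmem : ∀ C ∈ 𝒩, C ∈ 𝒞 ∧ ¬ Pos N C := fun C hC => by simpa [h𝒩] using hC
  obtain ⟨𝓑, b1, b2, b3⟩ := pairing (G := G) (σ := σ) S r _ 𝒩 Q rfl (hPG.mono hQP)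
    (by
      intro C hC
      obtain ⟨h1, h2⟩ := hmem C hC
      refine ⟨⟨hS C h1, ?_⟩, hr C h1⟩
      rw [neg_iff hN (hHG.mono (h𝒞.sub h1))]
      exact Nat.not_even_iff_odd.1 h2)
    (by
      intro C₁ h₁ C₂ h₂ hne u v a b c d
      exact max_dec h𝒞 hmax (hmem _ h₁).1 (hmem _ h₂).1 hne (hmem _ h₁).2 (hmem _ h₂).2
        (hS _ (hmem _ h₁).1) (hS _ (hmem _ h₂).1) a b c d)
    hQ
  refine ⟨𝒟.val + 𝓑 + (F1 + F2 + F3), ?_, ?_, ?_⟩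
  · intro C hC
    rcases Multiset.mem_add.1 hC with hC | hC
    · rcases Multiset.mem_add.1 hC with hC | hC
      · have h' : C ∈ 𝒞 ∧ Pos N C := by simpa [h𝒟] using hC
        refine Or.inl ⟨h𝒞.1 C h'.1, ?_⟩
        rw [neg_iff hN (hHG.mono (h𝒞.sub h'.1))]
        exact h'.2
      · exact Or.inr (b1 C hC)
    · exact hcirc C hC
  · intro e he
    by_cases hH : e ∈ N ∪ J
    · rw [← h𝒞.2.2] at hH
      obtain ⟨C, hC, heC⟩ := Finset.mem_biUnion.1 hH
      by_cases h : Pos N C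
      · refine ⟨C, Multiset.mem_add.2 (Or.inl (Multiset.mem_add.2 (Or.inl ?_))), heC⟩
        exact Finset.mem_filter.2 ⟨hC, h⟩
      · obtain ⟨B, hB1, hB2⟩ := b2 C (Finset.mem_filter.2 ⟨hC, h⟩)
        exact ⟨B, Multiset.mem_add.2 (Or.inl (Multiset.mem_add.2 (Or.inr hB1))), hB2 heC⟩
    · have heP : e ∈ P := by
        rw [hP]; refine ⟨he, fun h => hH (Finset.mem_union_left _ ((hN e).2 ⟨he, h⟩))⟩
      have heM : e ∈ M := by
        by_contra hcon
        exact hH (Finset.mem_union_right _ (hBJ (Finset.mem_sdiff.2 ⟨heP, hcon⟩)))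
      obtain ⟨C, a, b⟩ := hcovM e heM
      exact ⟨C, Multiset.mem_add.2 (Or.inr a), b⟩
  · have hsp : ∑ C ∈ 𝒟, C.card + ∑ C ∈ 𝒩, C.card = N.card + J.card := by
      rw [← Finset.card_union_of_disjoint hdJ, ← h𝒞.sum, h𝒩, h𝒟,
        Finset.sum_filter_add_sum_filter_not]
    have hup : ∀ A ⊆ P, A.card ≤ (P \ M).card + (A ∩ M).card := by
      intro A hA
      refine le_trans (Finset.card_le_card ?_) (Finset.card_union_le _ _)
      intro e he
      rw [Finset.mem_union, Finset.mem_sdiff, Finset.mem_inter]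
      by_cases e ∈ M
      · right; tauto
      · left; exact ⟨hA he, by assumption⟩
    have hJc := hup J hJP
    have hQc := hup Q hQP
    have h1 : (𝒟.val.map Finset.card).sum = ∑ C ∈ 𝒟, C.card := rfl
    rw [Multiset.map_add, Multiset.sum_add, hl, Multiset.map_add, Multiset.sum_add, h1]
    omega

end covering
end SC

/-! ## Part 8: switching, minimality -/
namespace SC
open Relation
open scoped Classical

section switching
variable [Fintype V]

lemma crosses_iff (U : Set V) (x y : V) : Crosses U s(x, y) ↔ (x ∈ U ↔ y ∉ U) := by
  constructor
  · rintro ⟨a, b, h, ha, hb⟩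
    rw [Sym2.eq_iff] at h
    rcases h with ⟨rfl, rfl⟩ | ⟨rfl, rfl⟩ <;> tauto
  · intro h
    by_cases hx : x ∈ U
    · exact ⟨x, y, rfl, hx, h.1 hx⟩
    · refine ⟨y, x, Sym2.eq_swap, ?_, hx⟩
      by_contra hy
      exact hx (h.2 hy)

lemma switch_switch (σ : Sym2 V → Bool) (U₀ U : Set V) :
    switchSign σ (symmDiff U₀ U) = switchSign (switchSign σ U₀) U := by
  funext e
  induction e using Sym2.ind with
  | _ x y =>
  unfold switchSign
  simp only [crosses_iff, Set.mem_symmDiff]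
  by_cases h1 : x ∈ U₀ <;> by_cases h2 : y ∈ U₀ <;> by_cases h3 : x ∈ U <;> by_cases h4 : y ∈ U <;>
    simp [h1, h2, h3, h4]

lemma card_cross (A : Finset (Sym2 V)) (U : Finset V) :
    (A.filter (Crosses (U : Set V))).card = (D A U Uᶜ).card := by
  symm
  refine Finset.card_bij (fun p _ => s(p.1, p.2)) ?_ ?_ ?_
  · rintro ⟨x, y⟩ h
    rw [mem_D] at h
    simp only [Finset.mem_compl] at h
    rw [Finset.mem_filter, crosses_iff]
    refine ⟨h.2, ?_⟩
    simp [h.1.1, h.1.2]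
  · rintro ⟨x, y⟩ h ⟨x', y'⟩ h' he
    rw [mem_D] at h h'
    simp only [Finset.mem_compl] at h h'
    simp only [Sym2.eq_iff] at he
    rcases he with ⟨rfl, rfl⟩ | ⟨rfl, rfl⟩
    · rfl
    · exact absurd h'.1.1 h.1.2
  · intro e he
    obtain ⟨he, x, y, rfl, hx, hy⟩ := Finset.mem_filter.1 he
    exact ⟨(x, y), mem_D.2 ⟨⟨by simpa using hx, by simpa using hy⟩, he⟩, rfl⟩

/-- switching does not change the sign of a cycle -/
lemma even_switch {G : SimpleGraph V} {σ : Sym2 V → Bool} {U : Set V} {C : Set (Sym2 V)} {S : Set V}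
    (h : IsCycleSet G C S) :
    Even {e ∈ C | switchSign σ U e = true}.ncard ↔ Even {e ∈ C | σ e = true}.ncard := by
  have hC : (C.toFinset : Set (Sym2 V)) = C := by simp
  have hcy : CycS G C.toFinset S := by unfold CycS; rw [hC]; exact h
  obtain ⟨hG, hE, -⟩ := hcy.data
  have hU : (U.toFinset : Set V) = U := by simp
  have hev := cut_even hG.ll hE U.toFinset
  rw [← card_cross, hU] at hev
  set F := C.toFinset
  have e1 : ∀ τ : Sym2 V → Bool, {e ∈ C | τ e = true}.ncard = (F.filter (fun e => τ e = true)).card := by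
    intro τ
    rw [← Set.ncard_coe_finset]
    congr 1
    ext e
    simp [F]
  rw [e1, e1]
  have e2 : F.filter (fun e => switchSign σ U e = true) =
      symmDiff (F.filter (fun e => σ e = true)) (F.filter (Crosses U)) := by
    ext e
    simp only [Finset.mem_filter, Finset.mem_symmDiff, switchSign]
    by_cases h1 : e ∈ F <;> by_cases h2 : Crosses U e <;> cases h3 : σ e <;> simp [h1, h2, h3]
  rw [e2]
  have e3 := card_symmDiff_add (F.filter (fun e => σ e = true)) (F.filter (Crosses U))
  have : ∀ a b c d : ℕ, a + 2 * b = c + d → Even d → (Even a ↔ Even c) := by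
    intro a b c d h hd
    rw [Nat.even_iff] at *
    rw [Nat.even_iff]
    omega
  exact this _ _ _ _ e3 hev

lemma circuit_switch {G : SimpleGraph V} {σ : Sym2 V → Bool} {U : Set V} {C : Set (Sym2 V)}
    (h : IsSignedCircuit G (switchSign σ U) C) : IsSignedCircuit G σ C := by
  have hn : ∀ C S, IsNegCycle G (switchSign σ U) C S → IsNegCycle G σ C S := by
    rintro C S ⟨h1, h2⟩
    refine ⟨h1, ?_⟩
    rw [← Nat.not_even_iff_odd] at *
    rwa [even_switch h1] at h2
  rcases h with ⟨⟨S, h1⟩, h2⟩ | ⟨C₁, C₂, h | h⟩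
  · exact Or.inl ⟨⟨S, h1⟩, (even_switch h1).1 h2⟩
  · obtain ⟨S₁, S₂, a, b, c⟩ := h
    exact Or.inr ⟨C₁, C₂, Or.inl ⟨S₁, S₂, hn _ _ a, hn _ _ b, c⟩⟩
  · obtain ⟨S₁, S₂, u, v, p, a, b, c⟩ := h
    exact Or.inr ⟨C₁, C₂, Or.inr ⟨S₁, S₂, u, v, p, hn _ _ a, hn _ _ b, c⟩⟩

/-- a signature of minimum size in the switching class -/
lemma exists_min (G : SimpleGraph V) (σ : Sym2 V → Bool) :
    ∃ U₀ : Set V, ∃ N P : Finset (Sym2 V),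
      (∀ e, e ∈ N ↔ e ∈ G.edgeSet ∧ switchSign σ U₀ e = true) ∧
      (∀ e, e ∈ P ↔ e ∈ G.edgeSet ∧ switchSign σ U₀ e ≠ true) ∧
      N.card = negativeness G σ ∧ ∀ U : Finset V, (D N U Uᶜ).card ≤ (D P U Uᶜ).card := by
  have hmem : negativeness G σ ∈ {n | ∃ U : Set V,
      n = {e | e ∈ G.edgeSet ∧ (∀ x ∈ e, x ∈ (Set.univ : Set V)) ∧ switchSign σ U e = true}.ncard} :=
    Nat.sInf_mem ⟨_, ∅, rfl⟩
  obtain ⟨U₀, hU₀⟩ := hmem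
  have hmin : ∀ U : Set V, negativeness G σ ≤
      {e | e ∈ G.edgeSet ∧ (∀ x ∈ e, x ∈ (Set.univ : Set V)) ∧ switchSign σ U e = true}.ncard :=
    fun U => Nat.sInf_le ⟨U, rfl⟩
  set E : Finset (Sym2 V) := G.edgeSet.toFinset with hE
  have hcard : ∀ τ : Sym2 V → Bool,
      {e | e ∈ G.edgeSet ∧ (∀ x ∈ e, x ∈ (Set.univ : Set V)) ∧ τ e = true}.ncard =
      (E.filter (fun e => τ e = true)).card := by
    intro τ
    rw [← Set.ncard_coe_finset]
    congr 1
    ext e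
    simp [hE]
  refine ⟨U₀, E.filter (fun e => switchSign σ U₀ e = true),
    E.filter (fun e => switchSign σ U₀ e ≠ true), by simp [hE], by simp [hE], ?_, ?_⟩
  · rw [hU₀, hcard]
  intro U
  have h := hmin (symmDiff U₀ (U : Set V))
  rw [hU₀, hcard, hcard, switch_switch] at h
  set τ := switchSign σ U₀
  set N := E.filter (fun e => τ e = true)
  set P := E.filter (fun e => τ e ≠ true)
  rw [← card_cross, ← card_cross]
  have e2 : E.filter (fun e => switchSign τ (U : Set V) e = true) =
      (N \ N.filter (Crosses (U : Set V))) ∪ P.filter (Crosses (U : Set V)) := by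
    ext e
    simp only [N, P, Finset.mem_filter, Finset.mem_union, Finset.mem_sdiff, switchSign]
    by_cases h1 : e ∈ E <;> by_cases h2 : Crosses (U : Set V) e <;> cases h3 : τ e <;> simp [h1, h2, h3]
  rw [e2] at h
  have h1 := Finset.card_union_le (N \ N.filter (Crosses (U : Set V))) (P.filter (Crosses (U : Set V)))
  have h2 := Finset.card_sdiff_add_card_eq_card (Finset.filter_subset (Crosses (U : Set V)) N)
  omega

lemma bless_of_tec {G : SimpleGraph V} (h : TwoEdgeConnected G) {E : Finset (Sym2 V)}
    (hE : ∀ e, e ∈ E ↔ e ∈ G.edgeSet) : Bless E := by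
  have hG : InG G E := fun e he => (hE e).1 he
  intro e he
  induction e using Sym2.ind with
  | _ x y =>
  have hb := h.2.2 s(x, y)
  rw [isBridge_iff, not_not] at hb
  obtain ⟨p⟩ := hb
  have hr := walk_rch p (Walk.end_mem_support p)
  have hsub : p.edges.toFinset ⊆ E \ {s(x, y)} := by
    intro f hf
    have := p.edges_subset_edgeSet (List.mem_toFinset.1 hf)
    rw [edgeSet_deleteEdges] at this
    rw [Finset.mem_sdiff, hE]
    exact ⟨this.1, by simpa using this.2⟩
  obtain ⟨A, hA, hAb⟩ := pathset (hG.ll.mono Finset.sdiff_subset) (hr.mono hsub)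
  have hxy : x ≠ y := by rintro rfl; exact hG.ll _ he
  refine ⟨symmDiff A {s(x, y)}, sd_sub (hA.trans Finset.sdiff_subset) (by simpa using he), ?_, ?_⟩
  · intro v
    rw [bd_symmDiff, hAb, bd_single hxy]
    have : ∀ a : ZMod 2, a + a = 0 := by decide
    exact this _
  · rw [Finset.mem_symmDiff]
    right
    refine ⟨by simp, fun h => ?_⟩
    have := hA h
    simp at this

theorem main (G : SimpleGraph V) (σ : Sym2 V → Bool) (h2ec : TwoEdgeConnected G)
    (heven : Even (negativeness G σ)) : ∃ 𝓕 : Multiset (Set (Sym2 V)),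
      IsSignedCircuitCover G σ 𝓕 ∧ 3 * circuitLength 𝓕 < 8 * G.edgeSet.ncard := by
  obtain ⟨U₀, N, P, hN, hP, hNc, hcut⟩ := exists_min G σ
  have hPG : InG G P := fun e he => ((hP e).1 he).1
  have hNG : InG G N := fun e he => ((hN e).1 he).1
  have hPL := hPG.ll
  have hdisj : Disjoint N P := by
    rw [Finset.disjoint_left]; intro e a b; exact ((hP e).1 b).2 ((hN e).1 a).2
  have hE : ∀ e, e ∈ N ∪ P ↔ e ∈ G.edgeSet := by
    intro e; rw [Finset.mem_union, hN, hP]; tauto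
  have hEG : InG G (N ∪ P) := fun e he => (hE e).1 he
  have hbl := bless_of_tec h2ec hE
  have hDdisj : ∀ {A B : Finset (Sym2 V)}, Disjoint A B → ∀ X Y : Finset V,
      (D (A ∪ B) X Y).card = (D A X Y).card + (D B X Y).card := by
    intro A B hAB X Y
    rw [← Finset.card_union_of_disjoint]
    · congr 1
      ext p
      simp only [Finset.mem_union, mem_D]
      tauto
    · rw [Finset.disjoint_left]
      intro p hp hq
      exact Finset.disjoint_left.1 hAB (mem_D.1 hp).2 (mem_D.1 hq).2
  -- the positive edges connect everything
  have hc : ∀ x y, Rch P x y := by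
    intro x y
    set U : Finset V := Finset.univ.filter (fun z => Rch P x z) with hU
    have hmU : ∀ z, z ∈ U ↔ Rch P x z := by intro z; simp [hU]
    have hP0 : (D P U Uᶜ).card = 0 := by
      rw [Finset.card_eq_zero, Finset.eq_empty_iff_forall_notMem]
      rintro ⟨a, b⟩ hab
      obtain ⟨⟨h1, h2⟩, h3⟩ := mem_D.1 hab
      rw [Finset.mem_compl, hmU] at h2
      rw [hmU] at h1
      exact h2 (h1.trans (Rch.single h3))
    have hN0 : (D N U Uᶜ).card = 0 := by have := hcut U; omega
    have hclosed : ∀ a b, G.Adj a b → a ∈ U → b ∈ U := by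
      intro a b hab ha
      by_contra hb
      have he : s(a, b) ∈ N ∪ P := (hE _).2 hab
      have : (a, b) ∈ D (N ∪ P) U Uᶜ := mem_D.2 ⟨⟨ha, by simpa using hb⟩, he⟩
      have h0 : (D (N ∪ P) U Uᶜ).card = 0 := by rw [hDdisj hdisj]; omega
      rw [Finset.card_eq_zero] at h0
      rw [h0] at this
      simp at this
    obtain ⟨p⟩ := h2ec.1.preconnected x y
    rw [← hmU]
    have : ∀ {a b : V} (p : G.Walk a b), a ∈ U → b ∈ U := by
      intro a b p
      induction p with
      | nil => exact id
      | cons h q ih => exact fun ha => ih (hclosed _ _ h ha)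
    exact this p ((hmU x).2 (Rch.refl x))
  set M := P.filter (fun e => ∃ Y ⊆ P, Ev Y ∧ e ∈ Y) with hMdef
  have hMP : M ⊆ P := Finset.filter_subset _ _
  have hM : Bless M := by
    intro e he
    obtain ⟨-, Y, hY, hYe, heY⟩ := Finset.mem_filter.1 he
    refine ⟨Y, ?_, hYe, heY⟩
    intro f hf
    exact Finset.mem_filter.2 ⟨hY hf, Y, hY, hYe, hf⟩
  have hB : ∀ J ⊆ P, Ev (N ∪ J) → P \ M ⊆ J := by
    intro J hJP hEv b hb
    obtain ⟨hbP, hbM⟩ := Finset.mem_sdiff.1 hb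
    induction b using Sym2.ind with
    | _ x y =>
    have hxy : x ≠ y := by rintro rfl; exact hPL _ hbP
    set U : Finset V := Finset.univ.filter (fun z => Rch (P \ {s(x, y)}) x z) with hU
    have hmU : ∀ z, z ∈ U ↔ Rch (P \ {s(x, y)}) x z := by intro z; simp [hU]
    have hxU : x ∈ U := (hmU x).2 (Rch.refl x)
    have hyU : y ∉ U := by
      intro hy
      obtain ⟨A, hA, hAb⟩ := pathset (hPL.mono Finset.sdiff_subset) ((hmU y).1 hy)
      apply hbM
      refine Finset.mem_filter.2 ⟨hbP, symmDiff A {s(x, y)},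
        sd_sub (hA.trans Finset.sdiff_subset) (by simpa using hbP), ?_, ?_⟩
      · intro v
        rw [bd_symmDiff, hAb, bd_single hxy]
        have : ∀ a : ZMod 2, a + a = 0 := by decide
        exact this _
      · rw [Finset.mem_symmDiff]
        right
        refine ⟨by simp, fun h => ?_⟩
        have := hA h
        simp at this
    have hDP : D P U Uᶜ = {(x, y)} := by
      ext ⟨a, c⟩
      rw [mem_D, Finset.mem_singleton, Finset.mem_compl]
      constructor
      · rintro ⟨⟨h1, h2⟩, h3⟩
        simp only at h1 h2 h3
        by_cases heq : s(a, c) = s(x, y)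
        · rw [Sym2.eq_iff] at heq
          rcases heq with ⟨rfl, rfl⟩ | ⟨rfl, rfl⟩
          · rfl
          · exact absurd hxU h2
        · exfalso
          apply h2
          rw [hmU] at h1 ⊢
          exact h1.trans (Rch.single (Finset.mem_sdiff.2 ⟨h3, by simpa using heq⟩))
      · intro h
        obtain ⟨rfl, rfl⟩ := Prod.mk.inj h
        exact ⟨⟨hxU, hyU⟩, hbP⟩
    have hDP1 : (D P U Uᶜ).card = 1 := by rw [hDP]; rfl
    have h1 := hcut U
    have h2 := hbl.cut hEG.ll U
    rw [hDdisj hdisj] at h2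
    have h3 := cut_even (hEG.mono (Finset.union_subset_union_right hJP)).ll hEv U
    rw [hDdisj (Finset.disjoint_of_subset_right hJP hdisj)] at h3
    by_contra hbJ
    have h4 : (D J U Uᶜ).card = 0 := by
      rw [Finset.card_eq_zero, Finset.eq_empty_iff_forall_notMem]
      intro p hp
      obtain ⟨h5, h6⟩ := mem_D.1 hp
      have : p ∈ D P U Uᶜ := mem_D.2 ⟨h5, hJP h6⟩
      rw [hDP, Finset.mem_singleton] at this
      subst this
      exact hbJ h6
    rw [Nat.even_iff] at h3
    omega
  have hEc : G.edgeSet.ncard = N.card + P.card := by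
    rw [← Finset.card_union_of_disjoint hdisj, ← Set.ncard_coe_finset]
    congr 1
    ext e
    rw [Finset.mem_coe, hE]
  have hpos : 0 < N.card + P.card := by
    obtain ⟨x, y, hxy⟩ := h2ec.2.1.exists_pair_ne
    rw [← Finset.card_union_of_disjoint hdisj, Finset.card_pos]
    by_contra hcon
    rw [Finset.not_nonempty_iff_eq_empty] at hcon
    have hP0 : P = ∅ := by
      apply Finset.subset_empty.1; rw [← hcon]; exact Finset.subset_union_right
    rcases ReflTransGen.cases_head (hc x y) with h | ⟨z, h, -⟩
    · exact hxy h
    · rw [hP0] at h; simp at h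
  obtain ⟨F, hF1, hF2, hF3⟩ := core hN hP (hNc ▸ heven) hc hMP hM hB hpos
  refine ⟨F.map (fun C : Finset (Sym2 V) => (C : Set (Sym2 V))), ⟨?_, ?_⟩, ?_⟩
  · intro C hC
    obtain ⟨C', hC', rfl⟩ := Multiset.mem_map.1 hC
    exact circuit_switch (hF1 C' hC')
  · intro e he
    obtain ⟨C, hC, heC⟩ := hF2 e he
    exact ⟨_, Multiset.mem_map_of_mem _ hC, by simpa using heC⟩
  · rw [hEc, circuitLength, Multiset.map_map]
    have : (F.map (Set.ncard ∘ fun C : Finset (Sym2 V) => (C : Set (Sym2 V)))) = F.map Finset.card :=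
      Multiset.map_congr rfl fun C _ => by simp
    rw [this]
    exact hF3

end switching
end SC

/-- a 2-edge-connected signed graph with even negativeness has a
signed-circuit cover of length less than `(8/3)|E(G)|`. -/
theorem stmt6 {V : Type*} [Fintype V] (G : SimpleGraph V) (σ : Sym2 V → Bool)
    (h2ec : TwoEdgeConnected G) (heven : Even (negativeness G σ)) :
    ∃ 𝓕 : Multiset (Set (Sym2 V)), IsSignedCircuitCover G σ 𝓕 ∧
      3 * circuitLength 𝓕 < 8 * G.edgeSet.ncard := by
  exact SC.main G σ h2ec heven
end

section
/- Let (G,σ) be a 2-edge-connected signed graph with |E⁻(G,σ)| ≥ 2 such that G⁺ is connected. Then (G,σ) has a signed-circuit D that is either a positive cycle containing at least one negative edge or a barbell, and which satisfies 2|E(D)| ≤ τ(G,σ) + |E(G)|. -/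
open SimpleGraph Set

variable {V : Type*}

lemma aux_append_isPath {V : Type*} {G : SimpleGraph V} {u v w : V} (p : G.Walk u v)
    (q : G.Walk v w) :
    (p.append q).IsPath ↔ p.IsPath ∧ q.IsPath ∧ ∀ z ∈ p.support, z ∈ q.support → z = v := by
  induction p with
  | nil => simp
  | cons h p ih =>
    rw [Walk.cons_append, Walk.cons_isPath_iff, ih q, Walk.cons_isPath_iff]
    simp only [Walk.mem_support_append_iff, Walk.support_cons, List.mem_cons, not_or]
    constructor
    · rintro ⟨⟨h1, h2, h3⟩, h4, h5⟩
      refine ⟨⟨h1, h4⟩, h2, ?_⟩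
      rintro z (rfl | hz) hq
      · exact absurd hq h5
      · exact h3 z hz hq
    · rintro ⟨⟨h1, h4⟩, h2, h3⟩
      refine ⟨⟨h1, h2, fun z hz => h3 z (Or.inr hz)⟩, h4, fun hq => ?_⟩
      have := h3 _ (Or.inl rfl) hq
      subst this
      exact h4 p.end_mem_support

lemma aux_first_hit {V : Type*} {G : SimpleGraph V} (S : Set V) {u v : V} (p : G.Walk u v)
    (h : ∃ z ∈ p.support, z ∈ S) :
    ∃ x ∈ S, ∃ (q : G.Walk u x) (r : G.Walk x v), p = q.append r ∧
      ∀ z ∈ q.support, z ∈ S → z = x := by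
  induction p with
  | nil =>
    obtain ⟨z, hz, hS⟩ := h
    simp only [Walk.support_nil, List.mem_singleton] at hz
    subst hz
    exact ⟨z, hS, Walk.nil, Walk.nil, rfl, by simp⟩
  | @cons a b c hadj p ih =>
    by_cases ha : a ∈ S
    · exact ⟨a, ha, Walk.nil, Walk.cons hadj p, rfl, by simp⟩
    · obtain ⟨z, hz, hS⟩ := h
      have hz' : z ∈ p.support := by
        rw [Walk.support_cons, List.mem_cons] at hz
        rcases hz with rfl | hz
        · exact absurd hS ha
        · exact hz
      obtain ⟨x, hx, q, r, rfl, hq⟩ := ih ⟨z, hz', hS⟩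
      refine ⟨x, hx, Walk.cons hadj q, r, rfl, ?_⟩
      intro t ht htS
      rw [Walk.support_cons, List.mem_cons] at ht
      rcases ht with rfl | ht
      · exact absurd htS ha
      · exact hq t ht htS

/-- The key counting argument: two disjoint nonempty vertex sets in a bridgeless connected graph
are joined by a path with at most half of the edges not inside either set. -/
lemma aux_short_path {V : Type*} [Fintype V] (G : SimpleGraph V) (hconn : G.Connected)
    (hbr : ∀ e, ¬ G.IsBridge e) (S₁ S₂ : Set V) (C : Set (Sym2 V))
    (hC : ∀ e ∈ C, (∀ x ∈ e, x ∈ S₁) ∨ (∀ x ∈ e, x ∈ S₂))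
    (h1 : S₁.Nonempty) (h2 : S₂.Nonempty) :
    ∃ (u v : V) (p : G.Walk u v), p.IsPath ∧ u ∈ S₁ ∧ v ∈ S₂ ∧
      {x | x ∈ p.support} ∩ S₁ = {u} ∧ {x | x ∈ p.support} ∩ S₂ = {v} ∧
      2 * p.length ≤ (G.edgeSet \ C).ncard := by
  classical
  let A : V → Set ℕ := fun x => {n | ∃ u ∈ S₁, ∃ w : G.Walk u x, w.length = n}
  have hA : ∀ x, (A x).Nonempty := fun x => by
    obtain ⟨u, hu⟩ := h1
    obtain ⟨w⟩ := hconn.preconnected u x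
    exact ⟨w.length, u, hu, w, rfl⟩
  let f : V → ℕ := fun x => sInf (A x)
  have hf0 : ∀ x ∈ S₁, f x = 0 := fun x hx =>
    Nat.le_zero.mp (Nat.sInf_le (show 0 ∈ A x from ⟨x, hx, Walk.nil, rfl⟩))
  have hfadj : ∀ x y, G.Adj x y → f y ≤ f x + 1 := by
    intro x y hxy
    obtain ⟨u, hu, w, hw⟩ := Nat.sInf_mem (hA x)
    exact Nat.sInf_le (show f x + 1 ∈ A y from ⟨u, hu, w.concat hxy, by
      rw [Walk.length_concat, hw]⟩)
  let L : Set ℕ := {n | ∃ u ∈ S₁, ∃ v ∈ S₂, ∃ w : G.Walk u v, w.length = n}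
  have hL : L.Nonempty := by
    obtain ⟨v, hv⟩ := h2
    obtain ⟨n, u, hu, w, hw⟩ := hA v
    exact ⟨n, u, hu, v, hv, w, hw⟩
  have hmin : ∀ u ∈ S₁, ∀ v ∈ S₂, ∀ w : G.Walk u v, sInf L ≤ w.length := fun u hu v hv w =>
    Nat.sInf_le (show w.length ∈ L from ⟨u, hu, v, hv, w, rfl⟩)
  have hfd : ∀ v ∈ S₂, sInf L ≤ f v := by
    intro v hv
    obtain ⟨u, hu, w, hw⟩ := Nat.sInf_mem (hA v)
    exact (hmin u hu v hv w).trans hw.le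
  obtain ⟨u, hu, v, hv, w, hw⟩ := Nat.sInf_mem hL
  have hpl : w.bypass.length = sInf L :=
    le_antisymm (w.length_bypass_le_length.trans hw.le) (hmin u hu v hv _)
  set p := w.bypass with hp
  have hpp : p.IsPath := w.bypass_isPath
  refine ⟨u, v, p, hpp, hu, hv, ?_, ?_, ?_⟩
  · ext x
    simp only [Set.mem_inter_iff, Set.mem_ofPred_eq, Set.mem_singleton_iff]
    constructor
    · rintro ⟨hx, hxS⟩
      obtain ⟨q, r, hqr⟩ := Walk.mem_support_iff_exists_append.mp hx
      have := hmin x hxS v hv r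
      rw [hqr, Walk.length_append] at hpl
      exact (Walk.eq_of_length_eq_zero (p := q) (by omega)).symm
    · rintro rfl
      exact ⟨p.start_mem_support, hu⟩
  · ext x
    simp only [Set.mem_inter_iff, Set.mem_ofPred_eq, Set.mem_singleton_iff]
    constructor
    · rintro ⟨hx, hxS⟩
      obtain ⟨q, r, hqr⟩ := Walk.mem_support_iff_exists_append.mp hx
      have := hmin u hu x hxS q
      rw [hqr, Walk.length_append] at hpl
      exact (Walk.eq_of_length_eq_zero (p := r) (by omega))
    · rintro rfl
      exact ⟨p.end_mem_support, hv⟩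
  · rw [hpl]
    let P : ℕ → Sym2 V → Prop := fun i e => ∃ x y, e = s(x, y) ∧ f x = i ∧ f y = i + 1
    have hPinj : ∀ i j e, P i e → P j e → i = j := by
      rintro i j e ⟨x, y, rfl, hx, hy⟩ ⟨x', y', he, hx', hy'⟩
      rcases Sym2.eq_iff.mp he with ⟨rfl, rfl⟩ | ⟨rfl, rfl⟩ <;> omega
    have key : ∀ i, i < sInf L → ∃ a b, a ≠ b ∧ a ∈ G.edgeSet \ C ∧ b ∈ G.edgeSet \ C ∧
        P i a ∧ P i b := by
      intro i hi
      have hnotC : ∀ e, P i e → e ∉ C := by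
        rintro e ⟨x, y, rfl, hx, hy⟩ he
        rcases hC _ he with h | h
        · have := hf0 y (h y (Sym2.mem_mk_right x y)); omega
        · have := hfd x (h x (Sym2.mem_mk_left x y)); omega
      have cross : ∀ x y, G.Adj x y → f x ≤ i → ¬ f y ≤ i → f x = i ∧ f y = i + 1 := by
        intro x y hxy hx hy
        have := hfadj x y hxy
        omega
      obtain ⟨d, -, hd1, hd2⟩ := p.exists_boundary_dart {x | f x ≤ i}
        (by simp [hf0 u hu]) (by have := hfd v hv; simp; omega)
      obtain ⟨hx, hy⟩ := cross _ _ d.adj hd1 hd2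
      have hb := hbr s(d.fst, d.snd)
      rw [isBridge_iff, not_not] at hb
      obtain ⟨q⟩ := hb
      obtain ⟨d', -, hd1', hd2'⟩ := q.exists_boundary_dart {x | f x ≤ i} hd1 hd2
      have hadj' := d'.adj
      rw [deleteEdges_adj] at hadj'
      obtain ⟨hx', hy'⟩ := cross _ _ hadj'.1 hd1' hd2'
      have P1 : P i s(d.fst, d.snd) := ⟨_, _, rfl, hx, hy⟩
      have P2 : P i s(d'.fst, d'.snd) := ⟨_, _, rfl, hx', hy'⟩
      exact ⟨_, _, fun h => hadj'.2 h.symm, ⟨d.adj, hnotC _ P1⟩, ⟨hadj'.1, hnotC _ P2⟩, P1, P2⟩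
    haveI : Nonempty (Sym2 V) := ⟨s(u, u)⟩
    choose! a b hab ha hb hPa hPb using key
    let g : Fin (sInf L) × Bool → (G.edgeSet \ C : Set (Sym2 V)) := fun z =>
      if z.2 then ⟨a z.1, ha _ z.1.2⟩ else ⟨b z.1, hb _ z.1.2⟩
    have hPg : ∀ z, P z.1 (g z) := by
      rintro ⟨i, t⟩
      cases t
      · exact hPb _ i.2
      · exact hPa _ i.2
    have hg : Function.Injective g := by
      rintro ⟨i, s⟩ ⟨j, t⟩ h
      have h1 := hPg (i, s)
      have h2 := hPg (j, t)
      rw [← h] at h2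
      have hij : i = j := Fin.ext (hPinj _ _ _ h1 h2)
      subst hij
      have hne := hab i i.2
      have h' := congrArg Subtype.val h
      cases s <;> cases t
      · rfl
      · exact absurd h'.symm hne
      · exact absurd h' hne
      · rfl
    have := Nat.card_le_card_of_injective g hg
    rw [Nat.card_coe_set_eq] at this
    simp only [Nat.card_eq_fintype_card, Fintype.card_prod, Fintype.card_fin,
      Fintype.card_bool] at this
    omega

lemma aux_negCycle_sub {V : Type*} {G : SimpleGraph V} {σ : Sym2 V → Bool} {C : Set (Sym2 V)}
    {S : Set V} (h : IsNegCycle G σ C S) :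
    C ⊆ G.edgeSet ∧ (∀ e ∈ C, ∀ x ∈ e, x ∈ S) ∧ S.Nonempty := by
  obtain ⟨⟨v, w, hw, rfl, rfl⟩, -⟩ := h
  refine ⟨fun e he => w.edges_subset_edgeSet he, fun e he x hx => ?_, ⟨v, w.start_mem_support⟩⟩
  exact Walk.mem_support_of_mem_edges he hx

/-- Two negative cycles with disjoint supports yield a short enough barbell. -/
lemma aux_disjoint {V : Type*} [Fintype V] (G : SimpleGraph V) (σ : Sym2 V → Bool)
    (h2ec : TwoEdgeConnected G) {C₁ C₂ : Set (Sym2 V)} {S₁ S₂ : Set V}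
    (hC₁ : IsNegCycle G σ C₁ S₁) (hC₂ : IsNegCycle G σ C₂ S₂) (hd : Disjoint S₁ S₂) :
    ∃ D, IsBarbell G σ D ∧ 2 * D.ncard ≤ C₁.ncard + C₂.ncard + G.edgeSet.ncard := by
  classical
  obtain ⟨s1, m1, n1⟩ := aux_negCycle_sub hC₁
  obtain ⟨s2, m2, n2⟩ := aux_negCycle_sub hC₂
  obtain ⟨u, v, p, hp, hu, hv, hpu, hpv, hlen⟩ := aux_short_path G h2ec.1 h2ec.2.2 S₁ S₂ (C₁ ∪ C₂)
    (by rintro e (he | he)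
        · exact Or.inl (m1 e he)
        · exact Or.inr (m2 e he)) n1 n2
  refine ⟨C₁ ∪ C₂ ∪ {e | e ∈ p.edges},
    ⟨C₁, C₂, Or.inr ⟨S₁, S₂, u, v, p, hC₁, hC₂, hd, hp, hu, hv, hpu, hpv, rfl⟩⟩, ?_⟩
  have e1 : {e | e ∈ p.edges}.ncard ≤ p.length := by
    have : {e | e ∈ p.edges} = (p.edges.toFinset : Set (Sym2 V)) := by ext; simp
    rw [this, Set.ncard_coe_finset, ← Walk.length_edges]
    exact List.toFinset_card_le _
  have e2 := Set.ncard_union_le (C₁ ∪ C₂) {e | e ∈ p.edges}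
  have e3 := Set.ncard_union_le C₁ C₂
  have e4 := Set.ncard_sdiff_add_ncard_of_subset (Set.union_subset s1 s2) (Set.toFinite _)
  omega

lemma aux_negCycle {V : Type*} {G : SimpleGraph V} {σ : Sym2 V → Bool} {a b : V}
    (p : G.Walk a b) (hp : p.IsPath) (hpos : ∀ e ∈ p.edges, σ e = false) (hab : G.Adj b a)
    (hs : σ s(b, a) = true) :
    IsNegCycle G σ {e | e ∈ (Walk.cons hab p).edges} {x | x ∈ p.support} := by
  refine ⟨⟨b, Walk.cons hab p, ?_, rfl, ?_⟩, ?_⟩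
  · rw [Walk.cons_isCycle_iff]
    refine ⟨hp, fun h => ?_⟩
    have := hpos _ h
    simp_all
  · ext x
    simp only [Set.mem_ofPred_eq, Walk.support_cons, List.mem_cons]
    constructor
    · exact Or.inr
    · rintro (rfl | h)
      · exact p.end_mem_support
      · exact h
  · have : {e ∈ {e | e ∈ (Walk.cons hab p).edges} | σ e = true} = {s(b, a)} := by
      ext e
      simp only [Set.mem_ofPred_eq, Walk.edges_cons, List.mem_cons, Set.mem_singleton_iff]
      constructor
      · rintro ⟨rfl | h, h'⟩
        · rfl
        · have := hpos _ h; simp_all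
      · rintro rfl
        exact ⟨Or.inl rfl, hs⟩
    rw [this, Set.ncard_singleton]
    exact odd_one

lemma aux_posCycle {V : Type*} {G : SimpleGraph V} {σ : Sym2 V → Bool} {a b c d x y : V}
    (A : G.Walk a x) (C : G.Walk y b) (Q : G.Walk c x) (R : G.Walk d y)
    (hA : A.IsPath) (hC : C.IsPath) (hQ : Q.IsPath) (hR : R.IsPath)
    (pA : ∀ e ∈ A.edges, σ e = false) (pC : ∀ e ∈ C.edges, σ e = false)
    (pQ : ∀ e ∈ Q.edges, σ e = false) (pR : ∀ e ∈ R.edges, σ e = false)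
    (dAC : ∀ z ∈ A.support, z ∉ C.support) (dQR : ∀ z ∈ Q.support, z ∉ R.support)
    (dQA : ∀ z ∈ Q.support, z ∈ A.support → z = x) (dQC : ∀ z ∈ Q.support, z ∉ C.support)
    (dRC : ∀ z ∈ R.support, z ∈ C.support → z = y) (dRA : ∀ z ∈ R.support, z ∉ A.support)
    (hab : G.Adj a b) (hcd : G.Adj c d) (sab : σ s(a, b) = true) (scd : σ s(c, d) = true)
    (hne : s(a, b) ≠ s(c, d)) :
    ∃ D, IsPosCycle G σ D ∧ ∃ e ∈ D, σ e = true := by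
  let W1 : G.Walk b x := Walk.cons hab.symm A
  let W : G.Walk d c := R.append (C.append (W1.append Q.reverse))
  have hW1 : W1.IsPath := (Walk.cons_isPath_iff _ _).mpr
    ⟨hA, fun h => dAC _ h C.end_mem_support⟩
  have hW : W.IsPath := by
    rw [aux_append_isPath, aux_append_isPath, aux_append_isPath]
    refine ⟨hR, ⟨hC, ⟨hW1, hQ.reverse, ?_⟩, ?_⟩, ?_⟩
    · intro z hz hzQ
      rw [Walk.support_reverse, List.mem_reverse] at hzQ
      rw [Walk.support_cons, List.mem_cons] at hz
      rcases hz with rfl | hz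
      · exact absurd C.end_mem_support (dQC _ hzQ)
      · exact dQA _ hzQ hz
    · intro z hz hz'
      simp only [Walk.mem_support_append_iff, Walk.support_reverse, List.mem_reverse,
        W1, Walk.support_cons, List.mem_cons] at hz'
      rcases hz' with (h | h) | h
      · exact h
      · exact absurd hz (dAC _ h)
      · exact absurd hz (dQC _ h)
    · intro z hz hz'
      simp only [Walk.mem_support_append_iff, Walk.support_reverse, List.mem_reverse,
        W1, Walk.support_cons, List.mem_cons] at hz'
      rcases hz' with h | (h | h) | h
      · exact dRC _ hz h
      · subst h
        exact dRC _ hz C.end_mem_support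
      · exact absurd h (dRA _ hz)
      · exact absurd hz (dQR _ h)
  have hed : ∀ e, e ∈ W.edges → e = s(a, b) ∨ σ e = false := by
    intro e he
    simp only [W, W1, Walk.edges_append, Walk.edges_cons, Walk.edges_reverse, List.mem_append,
      List.mem_cons, List.mem_reverse] at he
    rcases he with h | h | (h | h) | h
    · exact Or.inr (pR _ h)
    · exact Or.inr (pC _ h)
    · exact Or.inl (h.trans Sym2.eq_swap)
    · exact Or.inr (pA _ h)
    · exact Or.inr (pQ _ h)
  have hin : s(a, b) ∈ W.edges := by
    simp [W, W1, Walk.edges_append, Sym2.eq_swap]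
  have hcyc : (Walk.cons hcd W).IsCycle := by
    rw [Walk.cons_isCycle_iff]
    refine ⟨hW, fun h => ?_⟩
    rcases hed _ h with h | h
    · exact hne h.symm
    · simp_all
  refine ⟨{e | e ∈ (Walk.cons hcd W).edges}, ⟨⟨_, c, _, hcyc, rfl, rfl⟩, ?_⟩,
    s(c, d), by simp, scd⟩
  have : {e ∈ {e | e ∈ (Walk.cons hcd W).edges} | σ e = true} = {s(a, b), s(c, d)} := by
    ext e
    simp only [Set.mem_ofPred_eq, Walk.edges_cons, List.mem_cons, Set.mem_singleton_iff,
      Set.mem_insert_iff]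
    constructor
    · rintro ⟨rfl | h, h'⟩
      · exact Or.inr rfl
      · rcases hed _ h with h | h
        · exact Or.inl h
        · simp_all
    · rintro (rfl | rfl)
      · exact ⟨Or.inr hin, sab⟩
      · exact ⟨Or.inl rfl, scd⟩
  rw [this, Set.ncard_pair hne]
  exact even_two

lemma aux_pos_path {V : Type*} {G : SimpleGraph V} {σ : Sym2 V → Bool}
    (hpos : (gplus G σ).Connected) (a b : V) :
    ∃ p : G.Walk a b, p.IsPath ∧ ∀ e ∈ p.edges, σ e = false := by
  classical
  obtain ⟨w⟩ := hpos.preconnected a b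
  have hle : gplus G σ ≤ G := deleteEdges_le _
  refine ⟨w.bypass.mapLe hle, w.bypass_isPath.mapLe hle, fun e he => ?_⟩
  rw [Walk.edges_mapLe_eq_edges] at he
  have := Walk.edges_subset_edgeSet _ he
  rw [gplus, edgeSet_deleteEdges] at this
  simpa using this.2

lemma aux_ends {V : Type*} {G : SimpleGraph V} {a b x y : V}
    {A : G.Walk a x} {B : G.Walk x y} {C : G.Walk y b} (h : (A.append (B.append C)).IsPath)
    (hxy : x ≠ y) : ∀ z ∈ A.support, z ∉ C.support := by
  intro z hz hz'
  rw [aux_append_isPath, aux_append_isPath] at h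
  obtain ⟨-, ⟨-, -, h1⟩, h2⟩ := h
  have hzx := h2 z hz (by simp [hz'])
  subst hzx
  exact hxy (h1 z B.start_mem_support hz')

/-- A positive cycle through a negative edge or a barbell exists. -/
lemma aux_exists {V : Type*} [Fintype V] (G : SimpleGraph V) (σ : Sym2 V → Bool)
    (h2ec : TwoEdgeConnected G) (hneg : 2 ≤ (negEdgeSet G σ).ncard)
    (hpos : (gplus G σ).Connected) :
    ∃ D : Set (Sym2 V), (IsPosCycle G σ D ∧ ∃ e ∈ D, σ e = true) ∨ IsBarbell G σ D := by
  obtain ⟨e, he, f, hf, hef⟩ := (Set.one_lt_ncard (Set.toFinite _)).mp hneg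
  induction e with | _ a b
  induction f with | _ c d
  have hab : G.Adj a b := he.1
  have hcd : G.Adj c d := hf.1
  obtain ⟨P, hP, pP⟩ := aux_pos_path hpos a b
  obtain ⟨R, hR, pR⟩ := aux_pos_path hpos c d
  have N1 := aux_negCycle P hP pP hab.symm (by rw [Sym2.eq_swap]; exact he.2)
  have N2 := aux_negCycle R hR pR hcd.symm (by rw [Sym2.eq_swap]; exact hf.2)
  by_cases hmeet : ∃ z ∈ R.support, z ∈ {x | x ∈ P.support}
  swap
  · obtain ⟨D, hD, -⟩ := aux_disjoint G σ h2ec N1 N2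
      (Set.disjoint_left.mpr fun z h1 h2 => hmeet ⟨z, h2, h1⟩)
    exact ⟨D, Or.inr hD⟩
  obtain ⟨x, hx, Q, T, rfl, hQx⟩ := aux_first_hit _ R hmeet
  obtain ⟨y, hy, R', U, hT, hRy⟩ := aux_first_hit {x | x ∈ P.support} T.reverse
    ⟨x, by simp, hx⟩
  have hT' : T = U.reverse.append R'.reverse := by
    rw [← Walk.reverse_append, ← hT, Walk.reverse_reverse]
  subst hT'
  by_cases hxy : x = y
  · subst hxy
    have hU : U.reverse = Walk.nil := Walk.isPath_iff_eq_nil.mp hR.of_append_right.of_append_left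
    rw [hU] at N2
    refine ⟨_, Or.inr ⟨_, _, Or.inl ⟨_, _, N1, N2, ⟨x, ?_⟩, rfl⟩⟩⟩
    ext z
    simp only [Set.mem_inter_iff, Set.mem_ofPred_eq, Walk.mem_support_append_iff,
      Walk.support_reverse, List.mem_reverse, Set.mem_singleton_iff, Walk.support_nil,
      List.mem_singleton]
    constructor
    · rintro ⟨h1, h | h | h⟩
      · exact hQx z h h1
      · exact h
      · exact hRy z h h1
    · rintro rfl
      exact ⟨hx, Or.inr (Or.inl rfl)⟩
  · have dQR : ∀ z ∈ Q.support, z ∉ R'.support := fun z hz hz' =>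
      aux_ends hR hxy z hz (by simpa using hz')
    have hQ := hR.of_append_left
    have hR' : R'.IsPath := by
      rw [← Walk.isPath_reverse_iff]
      exact hR.of_append_right.of_append_right
    have pQ : ∀ e ∈ Q.edges, σ e = false := fun e he => pR e (by simp [Walk.edges_append, he])
    have pR' : ∀ e ∈ R'.edges, σ e = false := fun e he => pR e (by simp [Walk.edges_append, he])
    obtain ⟨A, B, hAB⟩ := Walk.mem_support_iff_exists_append.mp (show x ∈ P.support from hx)
    have hyP : y ∈ P.support := hy
    rw [hAB, Walk.mem_support_append_iff] at hyP
    rcases hyP with hyA | hyB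
    · obtain ⟨A1, A2, rfl⟩ := Walk.mem_support_iff_exists_append.mp hyA
      rw [← Walk.append_assoc] at hAB
      subst hAB
      have dAC := aux_ends hP (Ne.symm hxy)
      obtain ⟨D, hD⟩ := aux_posCycle (σ := σ) A1 B R' Q hP.of_append_left
        hP.of_append_right.of_append_right hR' hQ
        (fun e he => pP e (by simp [Walk.edges_append, he]))
        (fun e he => pP e (by simp [Walk.edges_append, he])) pR' pQ dAC
        (fun z hz hz' => dQR z hz' hz)
        (fun z hz hz' => hRy z hz (by simp [hz']))
        (fun z hz hz' => by
          have := hRy z hz (by simp [hz'])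
          subst this
          exact dAC z A1.end_mem_support hz')
        (fun z hz hz' => hQx z hz (by simp [hz']))
        (fun z hz hz' => by
          have := hQx z hz (by simp [hz'])
          subst this
          exact dAC z hz' B.start_mem_support)
        hab hcd.symm he.2 (by rw [Sym2.eq_swap]; exact hf.2)
        (by rw [Sym2.eq_swap (a := d)]; exact hef)
      exact ⟨D, Or.inl hD⟩
    · obtain ⟨B1, B2, rfl⟩ := Walk.mem_support_iff_exists_append.mp hyB
      subst hAB
      have dAC := aux_ends hP hxy
      obtain ⟨D, hD⟩ := aux_posCycle (σ := σ) A B2 Q R' hP.of_append_left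
        hP.of_append_right.of_append_right hQ hR'
        (fun e he => pP e (by simp [Walk.edges_append, he]))
        (fun e he => pP e (by simp [Walk.edges_append, he])) pQ pR' dAC dQR
        (fun z hz hz' => hQx z hz (by simp [hz']))
        (fun z hz hz' => by
          have := hQx z hz (by simp [hz'])
          subst this
          exact dAC z A.end_mem_support hz')
        (fun z hz hz' => hRy z hz (by simp [hz']))
        (fun z hz hz' => by
          have := hRy z hz (by simp [hz'])
          subst this
          exact dAC z hz' B2.start_mem_support)
        hab hcd he.2 hf.2 hef
      exact ⟨D, Or.inl hD⟩

/-- a 2-edge-connected signed graph with at least two negative edges and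
`G⁺` connected has a signed-circuit `D` (a positive cycle containing a negative edge,
or a barbell) with `2|E(D)| ≤ τ(G,σ) + |E(G)|`. -/
theorem stmt7 {V : Type*} [Fintype V] (G : SimpleGraph V) (σ : Sym2 V → Bool)
    (h2ec : TwoEdgeConnected G) (hneg : 2 ≤ (negEdgeSet G σ).ncard)
    (hpos : (gplus G σ).Connected) :
    ∃ D : Set (Sym2 V),
      ((IsPosCycle G σ D ∧ ∃ e ∈ D, σ e = true) ∨ IsBarbell G σ D) ∧
      2 * D.ncard ≤ tau G σ + G.edgeSet.ncard := by
  classical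
  by_cases hB : ∃ B, IsBarbell G σ B
  · have htau : tau G σ = sInf {n | ∃ B C₁ C₂, IsBarbellWith G σ B C₁ C₂ ∧
        n = C₁.ncard + C₂.ncard} := by
      rw [tau, if_pos hB]
    obtain ⟨B₀, C₁, C₂, h⟩ := hB
    obtain ⟨B, C₁, C₂, hB, hn⟩ := Nat.sInf_mem
      (s := {n | ∃ B C₁ C₂, IsBarbellWith G σ B C₁ C₂ ∧ n = C₁.ncard + C₂.ncard})
      ⟨_, B₀, C₁, C₂, h, rfl⟩
    rw [← htau] at hn
    rcases hB with hB | hB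
    · obtain ⟨S₁, S₂, h1, h2, ⟨v, hv⟩, rfl⟩ := id hB
      refine ⟨C₁ ∪ C₂, Or.inr ⟨C₁, C₂, Or.inl hB⟩, ?_⟩
      have e1 := Set.ncard_union_le C₁ C₂
      have e2 : (C₁ ∪ C₂).ncard ≤ G.edgeSet.ncard :=
        Set.ncard_le_ncard (Set.union_subset (aux_negCycle_sub h1).1 (aux_negCycle_sub h2).1)
          (Set.toFinite _)
      omega
    · obtain ⟨S₁, S₂, u, v, p, h1, h2, hd, -⟩ := id hB
      obtain ⟨D, hD, hle⟩ := aux_disjoint G σ h2ec h1 h2 hd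
      exact ⟨D, Or.inr hD, by omega⟩
  · obtain ⟨D, hD⟩ := aux_exists G σ h2ec hneg hpos
    refine ⟨D, hD, ?_⟩
    rw [tau, if_neg hB]
    rcases hD with ⟨⟨⟨S, v, w, -, rfl, -⟩, -⟩, -⟩ | hD
    · have : {e | e ∈ w.edges}.ncard ≤ G.edgeSet.ncard :=
        Set.ncard_le_ncard (fun e he => w.edges_subset_edgeSet he) (Set.toFinite _)
      omega
    · exact absurd ⟨D, hD⟩ hB
end
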